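/- Let f(z) = ∑_{k≥1} a_{2k−1} z^{2k−1} be odd and univalent (injective) in the unit disk 𝔻 with a_1 = 1, and let g(z) = ∑_{n≥1} b_n z^n be analytic in 𝔻 with g subordinate to f. Then for every 0 ≤ r < 1 one has ∑_{n≥1} |b_n|² r^n ≤ r/(1 − r²). -/

import Mathlib

section
open Real Set Filter Topology MeasureTheory


namespace BStar

/-- alternating sum over `2n` points -/
noncomputable def alt (φ : ℝ → ℝ) (n : ℕ) (p : ℕ → ℝ) : ℝ :=
  ∑ i ∈ Finset.range (2 * n), (-1 : ℝ) ^ (i + 1) * φ (p i)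

theorem alt_zero (φ : ℝ → ℝ) (p : ℕ → ℝ) : alt φ 0 p = 0 := by simp [alt]

theorem alt_succ (φ : ℝ → ℝ) (n : ℕ) (p : ℕ → ℝ) :
    alt φ (n + 1) p = alt φ n p + (φ (p (2 * n + 1)) - φ (p (2 * n))) := by
  unfold alt
  rw [show 2 * (n + 1) = 2 * n + 1 + 1 by ring, Finset.sum_range_succ, Finset.sum_range_succ]
  have h1 : (-1 : ℝ) ^ (2 * n + 1) = -1 := by rw [pow_succ, pow_mul]; simp
  have h2 : (-1 : ℝ) ^ (2 * n + 1 + 1) = 1 := by rw [pow_succ, h1]; simp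
  rw [h1, h2]; ring

theorem alt_eq_sum (φ : ℝ → ℝ) (n : ℕ) (p : ℕ → ℝ) :
    alt φ n p = ∑ i ∈ Finset.range n, (φ (p (2 * i + 1)) - φ (p (2 * i))) := by
  induction n with
  | zero => simp [alt]
  | succ n ih => rw [alt_succ, ih, Finset.sum_range_succ]

theorem alt_congr (φ : ℝ → ℝ) (n : ℕ) {p q : ℕ → ℝ} (h : ∀ i < 2 * n, p i = q i) :
    alt φ n p = alt φ n q := by
  unfold alt
  refine Finset.sum_congr rfl fun i hi => ?_
  rw [h i (Finset.mem_range.1 hi)]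

theorem alt_remove (φ : ℝ → ℝ) (n j : ℕ) (p : ℕ → ℝ) (hj : j + 1 < 2 * (n + 1))
    (h : p j = p (j + 1)) :
    alt φ (n + 1) p = alt φ n (fun i => if i < j then p i else p (i + 2)) := by
  obtain ⟨m, hm⟩ : ∃ m, 2 * n = j + m := ⟨2 * n - j, by omega⟩
  unfold alt
  have split : ∀ (F : ℕ → ℝ) (a b : ℕ), ∑ i ∈ Finset.range (a + b), F i =
      ∑ i ∈ Finset.range a, F i + ∑ i ∈ Finset.range b, F (a + i) := fun F a b => by
    induction b with
    | zero => simp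
    | succ b ih => rw [← add_assoc, Finset.sum_range_succ, ih, Finset.sum_range_succ]; ring
  rw [show 2 * (n + 1) = j + (1 + 1 + m) by omega, hm, split _ j, split _ (1 + 1), split _ j]
  have : ∑ x ∈ Finset.range (1 + 1), (-1 : ℝ) ^ (j + x + 1) * φ (p (j + x)) = 0 := by
    rw [Finset.sum_range_succ, Finset.sum_range_one, add_zero, h]
    ring
  rw [this, zero_add]
  have h1 : ∑ i ∈ Finset.range j, (-1 : ℝ) ^ (i + 1) * φ (p i) =
      ∑ i ∈ Finset.range j, (-1 : ℝ) ^ (i + 1) * φ (if i < j then p i else p (i + 2)) := by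
    refine Finset.sum_congr rfl fun i hi => ?_
    rw [if_pos (Finset.mem_range.1 hi)]
  rw [h1]
  have h2 : ∑ i ∈ Finset.range m, (-1 : ℝ) ^ (j + (1 + 1 + i) + 1) * φ (p (j + (1 + 1 + i))) =
      ∑ i ∈ Finset.range m, (-1 : ℝ) ^ (j + i + 1) *
        φ (if j + i < j then p (j + i) else p (j + i + 2)) := by
    refine Finset.sum_congr rfl fun i hi => ?_
    rw [if_neg (by omega)]
    rw [show j + (1 + 1 + i) = j + i + 2 by ring]
    ring
  rw [h2]

/-- a configuration of `n` intervals on a circle of length `π` -/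
def Cfg (n : ℕ) (p : ℕ → ℝ) : Prop :=
  (∀ i, i + 1 < 2 * n → p i ≤ p (i + 1)) ∧ ∀ i < 2 * n, p i ≤ p 0 + π

theorem Cfg.remove {n j : ℕ} {p : ℕ → ℝ} (hp : Cfg (n + 1) p)
    (h : p j = p (j + 1)) : Cfg n (fun i => if i < j then p i else p (i + 2)) := by
  refine ⟨fun i hi => ?_, fun i hi => ?_⟩
  · by_cases h1 : i + 1 < j
    · simp only [if_pos h1, if_pos (show i < j by omega)]
      exact hp.1 i (by omega)
    · by_cases h2 : i < j
      · have : i + 1 = j := by omega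
        simp only [if_pos h2, if_neg h1]
        have e1 := hp.1 i (by omega)
        have e2 := hp.1 (i + 2) (by omega)
        rw [this] at e1
        rw [show i + 2 = j + 1 by omega] at e2
        rw [show i + 1 + 2 = j + 1 + 1 by omega]
        linarith
      · simp only [if_neg h2, if_neg h1]
        exact hp.1 (i + 2) (by omega)
  · have h0 : p 0 ≤ (if 0 < j then p 0 else p (0 + 2)) := by
      split_ifs with hh
      · exact le_rfl
      · have e1 := hp.1 0 (by omega)
        have e2 := hp.1 1 (by omega)
        simp at *; linarith
    have : (if i < j then p i else p (i + 2)) ≤ p 0 + π := by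
      split_ifs
      · exact hp.2 i (by omega)
      · exact hp.2 (i + 2) (by omega)
    simp only at *
    linarith

theorem Cfg.pred {n : ℕ} {p : ℕ → ℝ} (hp : Cfg (n + 1) p) : Cfg n p :=
  ⟨fun i hi => hp.1 i (by omega), fun i hi => hp.2 i (by omega)⟩

theorem Cfg.len_nonneg {n : ℕ} {p : ℕ → ℝ} (hp : Cfg n p) : 0 ≤ alt id n p := by
  rw [alt_eq_sum]
  refine Finset.sum_nonneg fun i hi => ?_
  have := hp.1 (2 * i) (by have := Finset.mem_range.1 hi; omega)
  simp; linarith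

theorem Cfg.len_le' {n : ℕ} {p : ℕ → ℝ} (hp : Cfg (n + 1) p) :
    alt id (n + 1) p ≤ p (2 * n + 1) - p 0 := by
  induction n with
  | zero => rw [alt_succ, alt_zero]; simp
  | succ n ih =>
    rw [alt_succ]
    have := ih hp.pred
    have e2 := hp.1 (2 * n + 1) (by omega)
    simp only [id] at *
    rw [show 2 * n + 1 + 1 = 2 * (n + 1) by ring] at e2
    linarith

theorem Cfg.len_le {n : ℕ} {p : ℕ → ℝ} (hp : Cfg n p) : alt id n p ≤ π := by
  cases n with
  | zero => rw [alt_zero]; exact pi_pos.le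
  | succ n => have := hp.len_le'; have := hp.2 (2 * n + 1) (by omega); linarith

/-- flip of the point with index one -/
def flip (p : ℕ → ℝ) (s : ℝ) : ℕ → ℝ := fun i => if i = 1 then p 1 + s else p i - s

theorem alt_flip (φ : ℝ → ℝ) (n : ℕ) (p : ℕ → ℝ) (s : ℝ) :
    alt φ (n + 1) (flip p s) = alt φ (n + 1) (fun i => p i - s) + (φ (p 1 + s) - φ (p 1 - s)) := by
  induction n with
  | zero => simp [alt_succ, alt_zero, flip]
  | succ n ih =>
    rw [alt_succ, ih, alt_succ _ (n + 1)]
    simp only [flip, if_neg (show 2 * (n + 1) + 1 ≠ 1 by omega),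
      if_neg (show 2 * (n + 1) ≠ 1 by omega)]
    ring

theorem alt_id_flip (n : ℕ) (p : ℕ → ℝ) (s : ℝ) :
    alt id (n + 1) (flip p s) = alt id (n + 1) p + 2 * s := by
  rw [alt_flip, alt_eq_sum, alt_eq_sum]
  simp; ring

theorem cfg_flip {n : ℕ} {p : ℕ → ℝ} (hp : Cfg (n + 1) p) (s : ℝ) (h0 : 2 * |s| ≤ p 1 - p 0)
    (h1 : n = 0 ∨ 2 * |s| ≤ p 2 - p 1) (h2 : 0 < n ∨ 2 * |s| ≤ p 0 + π - p 1) :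
    Cfg (n + 1) (flip p s) := by
  have a1 := le_abs_self s
  have a2 := neg_abs_le s
  constructor
  · intro i hi
    rcases Nat.lt_trichotomy i 1 with h | h | h
    · obtain rfl : i = 0 := by omega
      simp [flip]; linarith
    · subst h
      rcases h1 with h1 | h1
      · omega
      · simp [flip]; linarith
    · have := hp.1 i hi
      simp only [flip, if_neg (show i ≠ 1 by omega), if_neg (show i + 1 ≠ 1 by omega)]
      linarith
  · intro i hi
    by_cases h : i = 1
    · subst h
      rcases h2 with h2 | h2
      · rcases h1 with h1 | h1
        · omega
        · have := hp.2 2 (by omega)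
          simp [flip]; linarith
      · simp [flip]; linarith
    · have := hp.2 i hi
      simp only [flip, if_neg h]
      simp; linarith

end BStar


namespace BStar

noncomputable def G (W : ℝ → ℝ → ℝ) (x y : ℝ) : ℝ := ∫ t in (0:ℝ)..y, W x t

theorem cont_G {W : ℝ → ℝ → ℝ} (hW : Continuous (Function.uncurry W)) :
    Continuous (Function.uncurry (G W)) :=
  intervalIntegral.continuous_parametric_primitive_of_continuous hW

theorem cont_slice {W : ℝ → ℝ → ℝ} (hW : Continuous (Function.uncurry W)) (x : ℝ) :
    Continuous (W x) := hW.comp (Continuous.prodMk_right x)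

theorem G_sub {W : ℝ → ℝ → ℝ} (hW : Continuous (Function.uncurry W)) (x a b : ℝ) :
    G W x b - G W x a = ∫ t in a..b, W x t := by
  unfold G
  rw [intervalIntegral.integral_interval_sub_left] <;>
  exact (cont_slice hW x).intervalIntegrable _ _

theorem alt_G {W : ℝ → ℝ → ℝ} (hW : Continuous (Function.uncurry W)) (x : ℝ) (n : ℕ) (p : ℕ → ℝ) :
    alt (G W x) n p = ∑ i ∈ Finset.range n, ∫ t in (p (2 * i))..(p (2 * i + 1)), W x t := by
  rw [alt_eq_sum]
  exact Finset.sum_congr rfl fun i _ => G_sub hW _ _ _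

theorem alt_G_shift {W : ℝ → ℝ → ℝ} (hW : Continuous (Function.uncurry W)) (x : ℝ) (n : ℕ)
    (p : ℕ → ℝ) (c : ℝ) :
    alt (G W x) n (fun i => p i + c) =
      ∑ i ∈ Finset.range n, ∫ t in (p (2 * i))..(p (2 * i + 1)), W x (t + c) := by
  rw [alt_G hW]
  refine Finset.sum_congr rfl fun i _ => ?_
  rw [intervalIntegral.integral_comp_add_right (fun t => W x t)]

theorem int_flip (F : ℝ → ℝ → ℝ) :
    ∫ φ in (0:ℝ)..(2 * π), F (cos φ) (-sin φ) = ∫ φ in (0:ℝ)..(2 * π), F (cos φ) (sin φ) := by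
  have := intervalIntegral.integral_comp_sub_left (a := 0) (b := 2 * π)
    (fun φ => F (cos φ) (sin φ)) (2 * π)
  simpa [cos_two_pi_sub, sin_two_pi_sub] using this

theorem avg_eq {W : ℝ → ℝ → ℝ} (hW : Continuous (Function.uncurry W)) (x0 h : ℝ) (n : ℕ)
    (p : ℕ → ℝ) :
    ∫ φ in (0:ℝ)..(2 * π), alt (G W (x0 + h * cos φ)) (n + 1) (flip p (-(h * sin φ))) =
      ∑ i ∈ Finset.range (n + 1), ∫ t in (p (2 * i))..(p (2 * i + 1)),
        ∫ φ in (0:ℝ)..(2 * π), W (x0 + h * cos φ) (t + h * sin φ) := by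
  have hG := cont_G hW
  have hGc : ∀ a b : ℝ → ℝ, Continuous a → Continuous b → Continuous fun φ => G W (a φ) (b φ) :=
    fun a b ha hb => hG.comp (ha.prodMk hb)
  have hWc : ∀ (a b : ℝ × ℝ → ℝ), Continuous a → Continuous b → Continuous fun φ => W (a φ) (b φ) :=
    fun a b ha hb => hW.comp (ha.prodMk hb)
  have e1 : ∀ φ, alt (G W (x0 + h * cos φ)) (n + 1) (flip p (-(h * sin φ))) =
      alt (G W (x0 + h * cos φ)) (n + 1) (fun i => p i + h * sin φ) +
      (G W (x0 + h * cos φ) (p 1 + -(h * sin φ)) - G W (x0 + h * cos φ) (p 1 + h * sin φ)) := by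
    intro φ
    rw [alt_flip]; simp only [sub_neg_eq_add]
  simp_rw [e1]
  have cA : Continuous fun φ => alt (G W (x0 + h * cos φ)) (n + 1) (fun i => p i + h * sin φ) := by
    unfold alt
    refine continuous_finsetSum _ fun i _ => continuous_const.mul (hGc _ _ ?_ ?_) <;> fun_prop
  have cB : Continuous fun φ => G W (x0 + h * cos φ) (p 1 + -(h * sin φ)) :=
    hGc _ _ (by fun_prop) (by fun_prop)
  have cC : Continuous fun φ => G W (x0 + h * cos φ) (p 1 + h * sin φ) :=
    hGc _ _ (by fun_prop) (by fun_prop)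
  have cD : Continuous fun φ => G W (x0 + h * cos φ) (p 1 + -(h * sin φ)) -
      G W (x0 + h * cos φ) (p 1 + h * sin φ) := cB.sub cC
  rw [intervalIntegral.integral_add (cA.intervalIntegrable _ _)
    (cD.intervalIntegrable _ _),
    intervalIntegral.integral_sub (cB.intervalIntegrable _ _) (cC.intervalIntegrable _ _)]
  have := int_flip (fun c s => G W (x0 + h * c) (p 1 + h * s))
  simp only [mul_neg] at this
  rw [this, sub_self, add_zero]
  simp_rw [alt_G_shift hW]
  rw [intervalIntegral.integral_finset_sum]
  · refine Finset.sum_congr rfl fun i _ => ?_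
    refine intervalIntegral_intervalIntegral_swap ?_
    have : Continuous (Function.uncurry fun φ t => W (x0 + h * cos φ) (t + h * sin φ)) :=
      hWc (fun q => x0 + h * cos q.1) (fun q => q.2 + h * sin q.1) (by fun_prop) (by fun_prop)
    refine (this.continuousOn.integrableOn_compact
      (isCompact_uIcc.prod isCompact_uIcc)).mono_set (Set.prod_mono uIoc_subset_uIcc uIoc_subset_uIcc)
  · intro i _
    refine Continuous.intervalIntegrable ?_ _ _
    refine intervalIntegral.continuous_parametric_intervalIntegral_of_continuous' ?_ _ _
    exact hWc (fun q => x0 + h * cos q.1) (fun q => q.2 + h * sin q.1) (by fun_prop) (by fun_prop)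

noncomputable def Vs (V : ℝ → ℝ → ℝ) (x θ : ℝ) : ℝ := ∫ t in (-θ)..θ, V x t

theorem Vs_eq {V : ℝ → ℝ → ℝ} (hV : Continuous (Function.uncurry V)) (x θ : ℝ) :
    Vs V x θ = G V x θ - G V x (-θ) := by rw [G_sub hV]; rfl

theorem cont_Vs {V : ℝ → ℝ → ℝ} (hV : Continuous (Function.uncurry V)) :
    Continuous (Function.uncurry (Vs V)) := by
  have : Function.uncurry (Vs V) = fun q : ℝ × ℝ => G V q.1 q.2 - G V q.1 (-q.2) := by
    ext ⟨x, θ⟩; exact Vs_eq hV x θ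
  rw [this]
  have hG := cont_G hV
  exact (hG.comp (continuous_fst.prodMk continuous_snd)).sub
    (hG.comp (continuous_fst.prodMk continuous_snd.neg))

theorem avg_Vs {V : ℝ → ℝ → ℝ} (hV : Continuous (Function.uncurry V)) (x0 h θ : ℝ)
    (hθ : 0 ≤ θ)
    (hm : ∀ y, |y| ≤ θ → ∫ φ in (0:ℝ)..(2 * π), V (x0 + h * cos φ) (y + h * sin φ)
      = 2 * π * V x0 y) :
    ∫ φ in (0:ℝ)..(2 * π), Vs V (x0 + h * cos φ) (θ + -(h * sin φ)) = 2 * π * Vs V x0 θ := by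
  have := avg_eq hV x0 h 0 (fun i => if i = 1 then θ else -θ)
  have e : ∀ φ, alt (G V (x0 + h * cos φ)) (0 + 1)
      (flip (fun i => if i = 1 then θ else -θ) (-(h * sin φ))) =
      Vs V (x0 + h * cos φ) (θ + -(h * sin φ)) := by
    intro φ
    rw [alt_succ, alt_zero, Vs_eq hV]
    simp [flip]; ring_nf
  simp_rw [e] at this
  rw [this]
  simp only [zero_add, Finset.range_one, Finset.sum_singleton, mul_zero,
    if_true, zero_ne_one, if_false]
  unfold Vs
  rw [← intervalIntegral.integral_const_mul]
  refine intervalIntegral.integral_congr fun t ht => ?_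
  rw [uIcc_of_le (by linarith)] at ht
  exact hm t (abs_le.2 ht)

theorem avg_W {W : ℝ → ℝ → ℝ} (hW : Continuous (Function.uncurry W)) (x0 h : ℝ) (n : ℕ)
    (p : ℕ → ℝ) (hp : Cfg (n + 1) p)
    (hm : ∀ y, 2 * π * W x0 y ≤ ∫ φ in (0:ℝ)..(2 * π), W (x0 + h * cos φ) (y + h * sin φ)) :
    2 * π * alt (G W x0) (n + 1) p ≤
    ∫ φ in (0:ℝ)..(2 * π), alt (G W (x0 + h * cos φ)) (n + 1) (flip p (-(h * sin φ))) := by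
  rw [avg_eq hW, alt_G hW, Finset.mul_sum]
  refine Finset.sum_le_sum fun i hi => ?_
  rw [← intervalIntegral.integral_const_mul]
  have hWc : ∀ (a b : ℝ × ℝ → ℝ), Continuous a → Continuous b → Continuous fun φ => W (a φ) (b φ) :=
    fun a b ha hb => hW.comp (ha.prodMk hb)
  refine intervalIntegral.integral_mono (hp.1 _ (by have := Finset.mem_range.1 hi; omega)) ?_ ?_ hm
  · exact ((cont_slice hW x0).const_mul _).intervalIntegrable _ _
  · refine Continuous.intervalIntegrable ?_ _ _
    refine intervalIntegral.continuous_parametric_intervalIntegral_of_continuous' ?_ _ _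
    exact hWc (fun q => x0 + h * cos q.2) (fun q => q.1 + h * sin q.2) (by fun_prop) (by fun_prop)

end BStar


namespace BStar

noncomputable def Ph (W V : ℝ → ℝ → ℝ) (δ : ℝ) (n : ℕ) (x : ℝ) (p : ℕ → ℝ) : ℝ :=
  alt (G W x) n p - Vs V x (alt id n p / 2) + δ * ((alt id n p / 2) ^ 2 - 4 * (alt id n p / 2))

theorem cont_alt {X : Type*} [TopologicalSpace X] {F : X → ℝ → ℝ} (n : ℕ)
    (hF : Continuous (Function.uncurry F)) :
    Continuous fun q : X × (ℕ → ℝ) => alt (F q.1) n q.2 := by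
  unfold alt
  refine continuous_finsetSum _ fun i _ => continuous_const.mul ?_
  exact hF.comp (continuous_fst.prodMk ((continuous_apply i).comp continuous_snd))

theorem cont_Ph {W V : ℝ → ℝ → ℝ} (hW : Continuous (Function.uncurry W))
    (hV : Continuous (Function.uncurry V)) (δ : ℝ) (n : ℕ) :
    Continuous fun q : ℝ × (ℕ → ℝ) => Ph W V δ n q.1 q.2 := by
  have h1 := cont_alt n (cont_G hW)
  have h2 : Continuous fun q : ℝ × (ℕ → ℝ) => alt id n q.2 :=
    cont_alt (F := fun _ => id) n continuous_snd
  have h3 : Continuous fun q : ℝ × (ℕ → ℝ) => Vs V q.1 (alt id n q.2 / 2) :=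
    (cont_Vs hV).comp (continuous_fst.prodMk (h2.div_const 2))
  unfold Ph
  fun_prop

theorem isClosed_Cfg (n : ℕ) : IsClosed {p : ℕ → ℝ | Cfg n p} := by
  unfold Cfg
  simp only [Set.setOf_and, Set.setOf_forall]
  refine IsClosed.inter ?_ ?_
  · refine isClosed_iInter fun i => isClosed_iInter fun _ => ?_
    exact isClosed_le (continuous_apply i) (continuous_apply (i + 1))
  · refine isClosed_iInter fun i => isClosed_iInter fun _ => ?_
    exact isClosed_le (continuous_apply i) ((continuous_apply 0).add continuous_const)

theorem normalize {W V : ℝ → ℝ → ℝ} (hW : Continuous (Function.uncurry W))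
    (per : ∀ x y, W x (y + π) = W x y) (δ : ℝ) (n : ℕ) (p : ℕ → ℝ) (hp : Cfg (n + 1) p) :
    ∃ q ∈ Set.pi univ (fun _ : ℕ => Icc (0:ℝ) (2 * π)) ∩ {q | Cfg (n + 1) q},
      ∀ x, Ph W V δ (n + 1) x q = Ph W V δ (n + 1) x p := by
  set k := ⌊p 0 / π⌋
  have hk1 : (k : ℝ) * π ≤ p 0 := by
    have := Int.floor_le (p 0 / π)
    rwa [le_div_iff₀ pi_pos] at this
  have hk2 : p 0 < (k : ℝ) * π + π := by
    have := Int.lt_floor_add_one (p 0 / π)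
    rw [div_lt_iff₀ pi_pos] at this
    linarith
  set q : ℕ → ℝ := fun i => if i < 2 * (n + 1) then p i - k * π else 0 with hq
  have hqi : ∀ i < 2 * (n + 1), q i = p i + -(k * π) := fun i hi => by
    simp only [hq, if_pos hi]; ring
  have mono : ∀ i < 2 * (n + 1), p 0 ≤ p i := by
    intro i
    induction i with
    | zero => intro _; exact le_rfl
    | succ i ih => intro hi; exact (ih (by omega)).trans (hp.1 i hi)
  refine ⟨q, ⟨?_, ?_, ?_⟩, ?_⟩
  · intro i _
    by_cases hi : i < 2 * (n + 1)
    · rw [hqi i hi]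
      have := mono i hi
      have := hp.2 i hi
      constructor <;> linarith
    · simp only [hq, if_neg hi]; exact ⟨le_rfl, by positivity⟩
  · intro i hi
    rw [hqi i (by omega), hqi _ hi]
    linarith [hp.1 i hi]
  · intro i hi
    rw [hqi i (by omega), hqi 0 (by omega)]
    linarith [hp.2 i hi]
  · intro x
    have e1 : alt id (n + 1) q = alt id (n + 1) p := by
      rw [alt_congr id (n + 1) hqi, alt_eq_sum, alt_eq_sum]; simp
    have e2 : alt (G W x) (n + 1) q = alt (G W x) (n + 1) p := by
      rw [alt_congr _ (n + 1) hqi, alt_G_shift hW, alt_G hW]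
      refine Finset.sum_congr rfl fun i _ => intervalIntegral.integral_congr fun t _ => ?_
      have : Function.Periodic (W x) π := per x
      have := this.sub_int_mul_eq (x := t) k
      simpa [sub_eq_add_neg] using this
    unfold Ph
    rw [e1, e2]

variable {W V : ℝ → ℝ → ℝ}

theorem left_bound (hW : Continuous (Function.uncurry W)) (hV : Continuous (Function.uncurry V))
    {x : ℝ} (hx : ∀ y y', W x y ≤ V x y') (n : ℕ) (p : ℕ → ℝ) (hp : Cfg n p) :
    alt (G W x) n p ≤ Vs V x (alt id n p / 2) := by
  obtain ⟨y, -, hy⟩ := (isCompact_Icc (a := -(π/2)) (b := π/2)).exists_isMinOn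
    (nonempty_Icc.2 (by linarith [pi_pos])) (cont_slice hV x).continuousOn
  have h1 : alt (G W x) n p ≤ V x y * alt id n p := by
    rw [alt_G hW, alt_eq_sum, Finset.mul_sum]
    refine Finset.sum_le_sum fun i hi => ?_
    have hi := hp.1 (2 * i) (by have := Finset.mem_range.1 hi; omega)
    calc _ ≤ ∫ t in (p (2 * i))..(p (2 * i + 1)), V x y :=
          intervalIntegral.integral_mono hi ((cont_slice hW x).intervalIntegrable _ _)
            (by simp) (fun t => hx t y)
      _ = _ := by simp; ring
  have hl := hp.len_nonneg
  have hu := hp.len_le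
  have h2 : V x y * alt id n p ≤ Vs V x (alt id n p / 2) := by
    unfold Vs
    calc V x y * alt id n p = ∫ t in (-(alt id n p / 2))..(alt id n p / 2), V x y := by
          simp; ring
      _ ≤ _ := intervalIntegral.integral_mono_on (by linarith) (by simp)
          ((cont_slice hV x).intervalIntegrable _ _) (fun t ht => hy ⟨by linarith [ht.1],
            by linarith [ht.2]⟩)
  linarith

theorem Vs_nonneg (V0 : ∀ x y, 0 ≤ V x y) {x θ : ℝ} (hθ : 0 ≤ θ) : 0 ≤ Vs V x θ :=
  intervalIntegral.integral_nonneg (by linarith) fun t _ => V0 x t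

theorem right_bound (hW : Continuous (Function.uncurry W)) 
    (V0 : ∀ x y, 0 ≤ V x y)
    {x : ℝ} (hx : ∀ y, W x y = 0) (n : ℕ) (p : ℕ → ℝ) (hp : Cfg n p) :
    alt (G W x) n p ≤ Vs V x (alt id n p / 2) := by
  have : alt (G W x) n p = 0 := by
    rw [alt_G hW]; simp [hx]
  rw [this]
  exact Vs_nonneg V0 (by linarith [hp.len_nonneg])

/-- no maximum at a clean configuration -/
theorem flip_contra (hW : Continuous (Function.uncurry W)) (hV : Continuous (Function.uncurry V))
    {h0 : ℝ} (hh0 : 0 < h0)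
    (sub : ∀ h, 0 < h → h < h0 → ∀ x y,
      2 * π * W x y ≤ ∫ φ in (0:ℝ)..(2 * π), W (x + h * cos φ) (y + h * sin φ))
    (mv : ∀ x y h, 0 < h → |y| + h < π / 2 →
      ∫ φ in (0:ℝ)..(2 * π), V (x + h * cos φ) (y + h * sin φ) = 2 * π * V x y)
    {δ : ℝ} (hδ : 0 < δ) (n : ℕ) (x0 : ℝ) (p : ℕ → ℝ) (hp : Cfg (n + 1) p)
    (hmax : ∀ x q, Cfg (n + 1) q → Ph W V δ (n + 1) x q ≤ Ph W V δ (n + 1) x0 p)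
    (c1 : p 0 < p 1) (c2 : n = 0 ∨ p 1 < p 2) (c3 : 0 < n ∨ p 1 < p 0 + π)
    (hL : alt id (n + 1) p < π) : False := by
  obtain ⟨d, hd, d1, d2, d3, d4, d5⟩ : ∃ d > 0, d < h0 ∧ 2 * d ≤ p 1 - p 0 ∧
      (n = 0 ∨ 2 * d ≤ p 2 - p 1) ∧ (0 < n ∨ 2 * d ≤ p 0 + π - p 1) ∧
      alt id (n + 1) p / 2 + d < π / 2 := by
    have key : ∀ a b : ℝ, a < b → ∀ᶠ d in 𝓝[>] (0:ℝ), 2 * d ≤ b - a := by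
      intro a b hab
      have : ∀ᶠ d in 𝓝 (0:ℝ), 2 * d < b - a := by
        apply ContinuousAt.eventually_lt <;> [fun_prop; fun_prop; simpa using hab]
      exact (this.filter_mono nhdsWithin_le_nhds).mono fun d hd => hd.le
    have e0 : ∀ᶠ d in 𝓝[>] (0:ℝ), d > 0 := eventually_mem_nhdsWithin
    have e1 : ∀ᶠ d in 𝓝[>] (0:ℝ), 2 * d ≤ h0 - 0 := key _ _ hh0
    have e2 := key _ _ c1
    have e3 : ∀ᶠ d in 𝓝[>] (0:ℝ), (n = 0 ∨ 2 * d ≤ p 2 - p 1) := by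
      rcases c2 with c | c
      · exact Eventually.of_forall fun _ => Or.inl c
      · exact (key _ _ c).mono fun _ => Or.inr
    have e4 : ∀ᶠ d in 𝓝[>] (0:ℝ), (0 < n ∨ 2 * d ≤ p 0 + π - p 1) := by
      rcases c3 with c | c
      · exact Eventually.of_forall fun _ => Or.inl c
      · exact (key _ _ c).mono fun _ => Or.inr
    have e5 := key (alt id (n + 1) p / 2) (π / 2) (by linarith)
    obtain ⟨d, h0, h1, h2, h3, h4, h5⟩ :=
      (e0.and (e1.and (e2.and (e3.and (e4.and e5))))).exists
    exact ⟨d, h0, by linarith, h2, h3, h4, by linarith⟩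
  set L := alt id (n + 1) p with hLdef
  have hL0 : 0 ≤ L := hp.len_nonneg
  have habs : ∀ φ, |(-(d * sin φ))| ≤ d := fun φ => by
    rw [abs_neg, abs_mul, abs_of_pos hd]
    exact mul_le_of_le_one_right hd.le (abs_sin_le_one φ)
  have hcfg : ∀ φ, Cfg (n + 1) (flip p (-(d * sin φ))) := fun φ => by
    have := habs φ
    refine cfg_flip hp _ (by linarith) ?_ ?_
    · rcases d3 with c | c
      · exact Or.inl c
      · right; linarith
    · rcases d4 with c | c
      · exact Or.inl c
      · right; linarith
  have hle : ∀ φ, Ph W V δ (n + 1) (x0 + d * cos φ) (flip p (-(d * sin φ))) ≤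
      Ph W V δ (n + 1) x0 p := fun φ => hmax _ _ (hcfg φ)
  have hform : ∀ φ, Ph W V δ (n + 1) (x0 + d * cos φ) (flip p (-(d * sin φ))) =
      alt (G W (x0 + d * cos φ)) (n + 1) (flip p (-(d * sin φ)))
      - Vs V (x0 + d * cos φ) (L / 2 + -(d * sin φ)) +
      δ * ((L / 2 + -(d * sin φ)) ^ 2 - 4 * (L / 2 + -(d * sin φ))) := fun φ => by
    unfold Ph
    rw [alt_id_flip, show (alt id (n + 1) p + 2 * -(d * sin φ)) / 2 = L / 2 + -(d * sin φ) by
      rw [hLdef]; ring]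
  have cA : Continuous fun φ => alt (G W (x0 + d * cos φ)) (n + 1) (flip p (-(d * sin φ))) := by
    have := cont_alt (n + 1) (cont_G hW)
    refine this.comp ((by fun_prop : Continuous fun φ => x0 + d * cos φ).prodMk
      (continuous_pi fun i => ?_))
    have hfl : Continuous fun φ : ℝ => flip p (-(d * sin φ)) i := by
      by_cases h : i = 1
      · simp only [flip, h, if_true]; fun_prop
      · simp only [flip, h, if_false]; fun_prop
    exact hfl
  have cB : Continuous fun φ => Vs V (x0 + d * cos φ) (L / 2 + -(d * sin φ)) :=
    (cont_Vs hV).comp ((by fun_prop : Continuous fun φ => x0 + d * cos φ).prodMk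
      (by fun_prop : Continuous fun φ => L / 2 + -(d * sin φ)))
  have cC : Continuous fun φ : ℝ => δ * ((L / 2 + -(d * sin φ)) ^ 2 - 4 * (L / 2 + -(d * sin φ))) := by
    fun_prop
  have cAB : Continuous fun φ => alt (G W (x0 + d * cos φ)) (n + 1) (flip p (-(d * sin φ)))
      - Vs V (x0 + d * cos φ) (L / 2 + -(d * sin φ)) := cA.sub cB
  have cABC : Continuous fun φ => alt (G W (x0 + d * cos φ)) (n + 1) (flip p (-(d * sin φ)))
      - Vs V (x0 + d * cos φ) (L / 2 + -(d * sin φ)) +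
      δ * ((L / 2 + -(d * sin φ)) ^ 2 - 4 * (L / 2 + -(d * sin φ))) := cAB.add cC
  have I1 : ∫ φ in (0:ℝ)..(2 * π), Ph W V δ (n + 1) (x0 + d * cos φ) (flip p (-(d * sin φ))) ≤
      2 * π * Ph W V δ (n + 1) x0 p := by
    calc _ ≤ ∫ φ in (0:ℝ)..(2 * π), Ph W V δ (n + 1) x0 p := by
          refine intervalIntegral.integral_mono (by positivity) ?_ (by simp) hle
          simp_rw [hform]
          exact cABC.intervalIntegrable _ _
      _ = _ := by simp
  have I2 : ∫ φ in (0:ℝ)..(2 * π), δ * ((L / 2 + -(d * sin φ)) ^ 2 - 4 * (L / 2 + -(d * sin φ)))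
      = 2 * π * (δ * ((L / 2) ^ 2 - 4 * (L / 2))) + δ * d ^ 2 * π := by
    have : ∀ φ, δ * ((L / 2 + -(d * sin φ)) ^ 2 - 4 * (L / 2 + -(d * sin φ))) =
      δ * ((L / 2) ^ 2 - 4 * (L / 2)) + ((δ * d * (4 - L)) * sin φ + (δ * d ^ 2) * sin φ ^ 2) := by
      intro φ; ring
    simp_rw [this]
    have j1 : ∫ φ in (0:ℝ)..(2 * π), (δ * d * (4 - L)) * sin φ = 0 := by
      rw [intervalIntegral.integral_const_mul, integral_sin]; simp
    have j2 : ∫ φ in (0:ℝ)..(2 * π), (δ * d ^ 2) * sin φ ^ 2 = δ * d ^ 2 * π := by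
      rw [intervalIntegral.integral_const_mul, integral_sin_sq]; simp
    rw [intervalIntegral.integral_add (by simp), intervalIntegral.integral_add, j1, j2,
      intervalIntegral.integral_const]
    · simp
    all_goals exact Continuous.intervalIntegrable (by fun_prop) _ _
  simp_rw [hform] at I1
  rw [intervalIntegral.integral_add (cAB.intervalIntegrable _ _) (cC.intervalIntegrable _ _),
    intervalIntegral.integral_sub (cA.intervalIntegrable _ _) (cB.intervalIntegrable _ _), I2,
    avg_Vs hV x0 d (L / 2) (by linarith) (fun y hy => mv x0 y d hd (by linarith))] at I1
  have I3 := avg_W hW x0 d n p hp (fun y => sub d hd d1 x0 y)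
  unfold Ph at I1
  rw [← hLdef] at I1
  have : 0 < δ * d ^ 2 * π := by positivity
  nlinarith

end BStar


namespace BStar

variable {W V : ℝ → ℝ → ℝ}

theorem Cfg.len_lt {n : ℕ} {p : ℕ → ℝ} (hp : Cfg (n + 2) p)
    (h : p (2 * n + 1) < p (2 * n + 2)) : alt id (n + 2) p < π := by
  rw [alt_succ]
  have h1 := hp.pred.len_le'
  have h2 := hp.2 (2 * n + 3) (by omega)
  simp only [id] at *
  rw [show 2 * (n + 1) = 2 * n + 2 by ring]
  rw [show 2 * n + 2 + 1 = 2 * n + 3 by ring]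
  linarith

theorem pen_nonpos {δ L : ℝ} (hδ : 0 < δ) (h0 : 0 ≤ L) (h1 : L ≤ π) :
    δ * ((L / 2) ^ 2 - 4 * (L / 2)) ≤ 0 := by
  have := pi_le_four
  apply mul_nonpos_of_nonneg_of_nonpos hδ.le
  nlinarith

theorem Vs_mono (hV : Continuous (Function.uncurry V)) (V0 : ∀ x y, 0 ≤ V x y) {x a b : ℝ}
    (ha : 0 ≤ a) (h : a ≤ b) : Vs V x a ≤ Vs V x b :=
  intervalIntegral.integral_mono_interval (by linarith) (by linarith) h
    (Eventually.of_forall fun t => V0 x t) ((cont_slice hV x).intervalIntegrable _ _)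

theorem alt_one (φ : ℝ → ℝ) (p : ℕ → ℝ) : alt φ 1 p = φ (p 1) - φ (p 0) := by
  rw [alt_eq_sum]; simp

theorem edge_contra (hW : Continuous (Function.uncurry W)) (hV : Continuous (Function.uncurry V))
    (W0 : ∀ x y, 0 ≤ W x y) (V0 : ∀ x y, 0 ≤ V x y) (per : ∀ x y, W x (y + π) = W x y)
    (edge : ∀ x, (∀ y, 0 < W x y) → ∫ t in (0:ℝ)..π, W x t ≤ Vs V x (π / 2))
    {δ : ℝ} (hδ : 0 < δ) (x0 : ℝ) (p : ℕ → ℝ)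
    (hmax : ∀ x q, Cfg 1 q → Ph W V δ 1 x q ≤ Ph W V δ 1 x0 p)
    (hpos : 0 < Ph W V δ 1 x0 p) (h1 : p 1 = p 0 + π) : False := by
  have hper : Function.Periodic (W x0) π := per x0
  have hpi := pi_pos
  have hpi4 := pi_le_four
  have hpi3 : π < 3.15 := pi_lt_d2
  have e : ∀ y, Ph W V δ 1 x0 p = (∫ t in y..(y + π), W x0 t) - Vs V x0 (π / 2)
      + δ * ((π / 2) ^ 2 - 4 * (π / 2)) := by
    intro y
    unfold Ph
    rw [alt_one, alt_one, G_sub hW, h1, hper.intervalIntegral_add_eq (p 0) y]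
    simp
  by_cases hw : ∀ y, 0 < W x0 y
  · have := edge x0 hw
    have e0 := e 0
    rw [zero_add] at e0
    have := pen_nonpos hδ hpi.le le_rfl
    linarith
  · push Not at hw
    obtain ⟨y, hy⟩ := hw
    have hy0 : W x0 (y + π) < δ / 4 := by rw [per]; linarith
    have hev : ∀ᶠ t in 𝓝 (y + π), W x0 t < δ / 4 :=
      (cont_slice hW x0).continuousAt.eventually_lt continuousAt_const hy0
    obtain ⟨ε, hε, hball⟩ := Metric.eventually_nhds_iff.1 hev
    obtain ⟨k, hk, hk1, hk2⟩ : ∃ k > 0, k < ε ∧ k < π :=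
      ⟨min ε π / 2, by positivity, by
        have := min_le_left ε π; have : 0 < min ε π := lt_min hε hpi
        linarith, by
        have := min_le_right ε π; have : 0 < min ε π := lt_min hε hpi
        linarith⟩
    set q : ℕ → ℝ := fun i => if i = 0 then y else y + π - k with hq
    have q0 : q 0 = y := rfl
    have q1 : q 1 = y + π - k := rfl
    have hc : Cfg 1 q := by
      refine ⟨fun i hi => ?_, fun i hi => ?_⟩
      · have : i = 0 := by omega
        subst this
        rw [q0, zero_add, q1]; linarith
      · have : i = 0 ∨ i = 1 := by omega
        rcases this with rfl | rfl
        · rw [q0]; linarith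
        · rw [q0, q1]; linarith
    have hm := hmax x0 q hc
    rw [e y] at hm
    unfold Ph at hm
    rw [alt_one, alt_one, G_sub hW, q0, q1] at hm
    simp only [id] at hm
    have e2 : (y + π - k - y) / 2 = π / 2 - k / 2 := by ring
    rw [e2] at hm
    have hs : ∫ t in y..(y + π), W x0 t = (∫ t in y..(y + π - k), W x0 t) +
        ∫ t in (y + π - k)..(y + π), W x0 t :=
      (intervalIntegral.integral_add_adjacent_intervals
        ((cont_slice hW x0).intervalIntegrable _ _)
        ((cont_slice hW x0).intervalIntegrable _ _)).symm
    have hb : ∫ t in (y + π - k)..(y + π), W x0 t ≤ k * (δ / 4) := by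
      calc _ ≤ ∫ t in (y + π - k)..(y + π), δ / 4 := by
            refine intervalIntegral.integral_mono_on (by linarith)
              ((cont_slice hW x0).intervalIntegrable _ _) (by simp) fun t ht => ?_
            refine (hball ?_).le
            rw [Real.dist_eq, abs_lt]
            constructor <;> linarith [ht.1, ht.2]
        _ = _ := by simp; ring
    have hv : Vs V x0 (π / 2 - k / 2) ≤ Vs V x0 (π / 2) :=
      Vs_mono hV V0 (by linarith) (by linarith)
    have : 0 < δ * k := by positivity
    have h3 : δ * ((π / 2 - k / 2) ^ 2 - 4 * (π / 2 - k / 2)) =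
      δ * ((π / 2) ^ 2 - 4 * (π / 2)) + (δ * k) * (2 - π / 2 + k / 4) := by ring
    have h4 : (δ * k) * 0.4 ≤ (δ * k) * (2 - π / 2 + k / 4) := by
      apply mul_le_mul_of_nonneg_left _ this.le
      linarith
    rw [h3] at hm
    linarith

theorem star_delta (hW : Continuous (Function.uncurry W)) (hV : Continuous (Function.uncurry V))
    (W0 : ∀ x y, 0 ≤ W x y) (V0 : ∀ x y, 0 ≤ V x y) (per : ∀ x y, W x (y + π) = W x y)
    {h0 : ℝ} (hh0 : 0 < h0)
    (sub : ∀ h, 0 < h → h < h0 → ∀ x y,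
      2 * π * W x y ≤ ∫ φ in (0:ℝ)..(2 * π), W (x + h * cos φ) (y + h * sin φ))
    (mv : ∀ x y h, 0 < h → |y| + h < π / 2 →
      ∫ φ in (0:ℝ)..(2 * π), V (x + h * cos φ) (y + h * sin φ) = 2 * π * V x y)
    (X : ℝ) (right : ∀ x, X ≤ x → ∀ y, W x y = 0)
    (left : ∀ x, x ≤ -X → ∀ y y', W x y ≤ V x y')
    (edge : ∀ x, (∀ y, 0 < W x y) → ∫ t in (0:ℝ)..π, W x t ≤ Vs V x (π / 2))
    {δ : ℝ} (hδ : 0 < δ) (n : ℕ) : ∀ p, Cfg n p → ∀ x, Ph W V δ n x p ≤ 0 := by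
  induction n with
  | zero => intro p _ x; unfold Ph; simp [alt_zero, Vs]
  | succ n ih =>
    by_contra hcon
    push Not at hcon
    obtain ⟨p1, hp1, x1, hpos⟩ := hcon
    have out : ∀ x ∉ Icc (-X) X, ∀ q, Cfg (n + 1) q → Ph W V δ (n + 1) x q ≤ 0 := by
      intro x hx q hq
      have h1 : alt (G W x) (n + 1) q ≤ Vs V x (alt id (n + 1) q / 2) := by
        by_cases hx1 : x ≤ -X
        · exact left_bound hW hV (left x hx1) _ _ hq
        · have : X ≤ x := by
            by_contra h; exact hx ⟨by linarith, by linarith⟩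
          exact right_bound hW V0 (right x this) _ _ hq
      have := pen_nonpos hδ hq.len_nonneg hq.len_le
      unfold Ph
      linarith
    have hx1 : x1 ∈ Icc (-X) X := by
      by_contra h; exact absurd (out x1 h p1 hp1) (not_le.2 hpos)
    have hK : IsCompact (Icc (-X) X ×ˢ (Set.pi univ (fun _ : ℕ => Icc (0:ℝ) (2 * π)) ∩
        {q | Cfg (n + 1) q})) :=
      isCompact_Icc.prod ((isCompact_univ_pi fun _ => isCompact_Icc).inter_right (isClosed_Cfg _))
    obtain ⟨q1, hq1, hq1e⟩ := normalize (V := V) hW per δ n p1 hp1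
    obtain ⟨⟨x0, p⟩, ⟨hx0, hpm⟩, hm⟩ := hK.exists_isMaxOn ⟨(x1, q1), hx1, hq1⟩
      (cont_Ph hW hV δ (n + 1)).continuousOn
    have hp : Cfg (n + 1) p := hpm.2
    have hpos0 : 0 < Ph W V δ (n + 1) x0 p := by
      have := hm (show (x1, q1) ∈ _ from ⟨hx1, hq1⟩)
      simp only [mem_setOf_eq] at this
      rw [hq1e] at this
      exact hpos.trans_le this
    have hmax : ∀ x q, Cfg (n + 1) q → Ph W V δ (n + 1) x q ≤ Ph W V δ (n + 1) x0 p := by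
      intro x q hq
      by_cases hx : x ∈ Icc (-X) X
      · obtain ⟨q2, hq2, hq2e⟩ := normalize (V := V) hW per δ n q hq
        have := hm (show (x, q2) ∈ _ from ⟨hx, hq2⟩)
        simp only [mem_setOf_eq] at this
        rwa [hq2e] at this
      · exact (out x hx q hq).trans hpos0.le
    by_cases hj : ∃ j, j + 1 < 2 * (n + 1) ∧ p j = p (j + 1)
    · obtain ⟨j, hj1, hj2⟩ := hj
      have := ih _ (hp.remove hj2) x0
      unfold Ph at this hpos0
      rw [alt_remove _ n j p hj1 hj2, alt_remove _ n j p hj1 hj2] at hpos0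
      linarith
    · push Not at hj
      have st : ∀ j, j + 1 < 2 * (n + 1) → p j < p (j + 1) := fun j h =>
        lt_of_le_of_ne (hp.1 j h) (hj j h)
      have c1 := st 0 (by omega)
      rcases n with _ | n
      · by_cases h1 : p 1 = p 0 + π
        · exact edge_contra hW hV W0 V0 per edge hδ x0 p hmax hpos0 h1
        · have h2 : p 1 < p 0 + π := lt_of_le_of_ne (hp.2 1 (by omega)) h1
          refine flip_contra hW hV hh0 sub mv hδ 0 x0 p hp hmax c1 (Or.inl rfl) (Or.inr h2) ?_
          rw [zero_add, alt_one]; simp only [id]; linarith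
      · exact flip_contra hW hV hh0 sub mv hδ (n + 1) x0 p hp hmax c1
          (Or.inr (st 1 (by omega))) (Or.inl (by omega)) (hp.len_lt (st _ (by omega)))

theorem star (hW : Continuous (Function.uncurry W)) (hV : Continuous (Function.uncurry V))
    (W0 : ∀ x y, 0 ≤ W x y) (V0 : ∀ x y, 0 ≤ V x y) (per : ∀ x y, W x (y + π) = W x y)
    {h0 : ℝ} (hh0 : 0 < h0)
    (sub : ∀ h, 0 < h → h < h0 → ∀ x y,
      2 * π * W x y ≤ ∫ φ in (0:ℝ)..(2 * π), W (x + h * cos φ) (y + h * sin φ))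
    (mv : ∀ x y h, 0 < h → |y| + h < π / 2 →
      ∫ φ in (0:ℝ)..(2 * π), V (x + h * cos φ) (y + h * sin φ) = 2 * π * V x y)
    (X : ℝ) (right : ∀ x, X ≤ x → ∀ y, W x y = 0)
    (left : ∀ x, x ≤ -X → ∀ y y', W x y ≤ V x y')
    (edge : ∀ x, (∀ y, 0 < W x y) → ∫ t in (0:ℝ)..π, W x t ≤ Vs V x (π / 2))
    (n : ℕ) (p : ℕ → ℝ) (hp : Cfg n p) (x : ℝ) :
    alt (G W x) n p ≤ Vs V x (alt id n p / 2) := by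
  have key : ∀ δ > 0, alt (G W x) n p - Vs V x (alt id n p / 2) +
      δ * ((alt id n p / 2) ^ 2 - 4 * (alt id n p / 2)) ≤ 0 := fun δ hδ =>
    star_delta hW hV W0 V0 per hh0 sub mv X right left edge hδ n p hp x
  have ht : Tendsto (fun δ : ℝ => alt (G W x) n p - Vs V x (alt id n p / 2) +
      δ * ((alt id n p / 2) ^ 2 - 4 * (alt id n p / 2))) (𝓝[>] 0)
      (𝓝 (alt (G W x) n p - Vs V x (alt id n p / 2) +
      0 * ((alt id n p / 2) ^ 2 - 4 * (alt id n p / 2)))) :=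
    (Continuous.tendsto (by fun_prop) 0).mono_left nhdsWithin_le_nhds
  have := le_of_tendsto ht (eventually_mem_nhdsWithin.mono fun δ hδ => key δ hδ)
  linarith

end BStar


namespace BStar

structure Sch (f : ℂ → ℂ) : Prop where
  diff : DifferentiableOn ℂ f (Metric.ball 0 1)
  inj : InjOn f (Metric.ball 0 1)
  odd : ∀ z ∈ Metric.ball (0:ℂ) 1, f (-z) = - f z
  der : deriv f 0 = 1

variable {f : ℂ → ℂ}

theorem Sch.zero (h : Sch f) : f 0 = 0 := by
  have := h.odd 0 (by simp)
  rw [neg_zero] at this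
  exact self_eq_neg.1 this

theorem Sch.an (h : Sch f) {z : ℂ} (hz : z ∈ Metric.ball (0:ℂ) 1) : AnalyticAt ℂ f z :=
  h.diff.analyticAt (Metric.isOpen_ball.mem_nhds hz)

theorem Sch.not_const (h : Sch f) {z : ℂ} (hz : z ∈ Metric.ball (0:ℂ) 1) :
    ¬ ∀ᶠ x in 𝓝 z, f x = f z := by
  intro hc
  have h1 : ∀ᶠ x in 𝓝 z, x ∈ Metric.ball (0:ℂ) 1 := Metric.isOpen_ball.mem_nhds hz
  have h2 : ∀ᶠ x in 𝓝[≠] z, f x = f z ∧ x ∈ Metric.ball (0:ℂ) 1 ∧ x ≠ z :=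
    ((hc.and h1).filter_mono nhdsWithin_le_nhds).and eventually_mem_nhdsWithin |>.mono
      fun x hx => ⟨hx.1.1, hx.1.2, hx.2⟩
  obtain ⟨x, hx1, hx2, hx3⟩ := h2.exists
  exact hx3 (h.inj hx2 hz hx1)

theorem Sch.nhds_le (h : Sch f) {z : ℂ} (hz : z ∈ Metric.ball (0:ℂ) 1) :
    𝓝 (f z) ≤ map f (𝓝 z) :=
  (h.an hz).eventually_constant_or_nhds_le_map_nhds.resolve_left (h.not_const hz)

theorem Sch.image_open (h : Sch f) {s : Set ℂ} (hs : IsOpen s) (hsub : s ⊆ Metric.ball 0 1) :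
    IsOpen (f '' s) := by
  rw [isOpen_iff_mem_nhds]
  rintro _ ⟨z, hz, rfl⟩
  exact h.nhds_le (hsub hz) (image_mem_map (hs.mem_nhds hz))

/-- inverse function -/
noncomputable def qq (f : ℂ → ℂ) : ℂ → ℂ := Function.invFunOn f (Metric.ball 0 1)

theorem Sch.q_f (h : Sch f) {z : ℂ} (hz : z ∈ Metric.ball (0:ℂ) 1) : qq f (f z) = z :=
  h.inj.leftInvOn_invFunOn hz

theorem q_mem {w : ℂ} (hw : w ∈ f '' Metric.ball 0 1) : qq f w ∈ Metric.ball (0:ℂ) 1 :=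
  Function.invFunOn_mem hw

theorem f_q {w : ℂ} (hw : w ∈ f '' Metric.ball 0 1) : f (qq f w) = w :=
  Function.invFunOn_eq hw

theorem Sch.q_cont (h : Sch f) {w : ℂ} (hw : w ∈ f '' Metric.ball 0 1) : ContinuousAt (qq f) w := by
  obtain ⟨z, hz, rfl⟩ := hw
  unfold ContinuousAt
  rw [h.q_f hz]
  intro N hN
  have h1 : N ∩ Metric.ball 0 1 ∈ 𝓝 z := inter_mem hN (Metric.isOpen_ball.mem_nhds hz)
  have h2 : f '' (N ∩ Metric.ball 0 1) ∈ 𝓝 (f z) := h.nhds_le hz (image_mem_map h1)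
  rw [mem_map]
  refine mem_of_superset h2 ?_
  rintro _ ⟨x, ⟨hx1, hx2⟩, rfl⟩
  simpa [h.q_f hx2] using hx1

theorem Sch.D_open (h : Sch f) : IsOpen (f '' Metric.ball 0 1) :=
  h.image_open Metric.isOpen_ball le_rfl

theorem Sch.q_deriv (h : Sch f) {w : ℂ} (hw : w ∈ f '' Metric.ball 0 1)
    (hd : deriv f (qq f w) ≠ 0) : HasDerivAt (qq f) (deriv f (qq f w))⁻¹ w := by
  refine HasDerivAt.of_local_left_inverse (h.q_cont hw)
    (h.an (q_mem hw)).differentiableAt.hasDerivAt hd ?_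
  filter_upwards [h.D_open.mem_nhds hw] with y hy using f_q hy

theorem Sch.q_an (h : Sch f) {w : ℂ} (hw : w ∈ f '' Metric.ball 0 1) : AnalyticAt ℂ (qq f) w := by
  refine Complex.analyticAt_of_differentiable_on_punctured_nhds_of_continuousAt ?_ (h.q_cont hw)
  have hz := q_mem hw
  have h1 : ∀ᶠ z in 𝓝[≠] (qq f w), deriv f z ≠ 0 := by
    refine (h.an hz).deriv.eventually_eq_zero_or_eventually_ne_zero.resolve_left fun h0 => ?_
    apply h.not_const hz
    obtain ⟨r, hr, hball⟩ := Metric.eventually_nhds_iff_ball.1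
      (h0.and (Metric.isOpen_ball.mem_nhds hz))
    filter_upwards [Metric.ball_mem_nhds _ hr] with x hx
    exact (convex_ball (qq f w) r).is_const_of_fderivWithin_eq_zero (𝕜 := ℂ)
      (fun y hy => (h.an (hball y hy).2).differentiableAt.differentiableWithinAt)
      (fun y hy => by
        rw [fderivWithin_of_isOpen Metric.isOpen_ball hy]
        ext
        simpa using (hball y hy).1) hx (Metric.mem_ball_self hr)
  have h2 : Tendsto (qq f) (𝓝[≠] w) (𝓝[≠] (qq f w)) := by
    refine tendsto_nhdsWithin_iff.2 ⟨(h.q_cont hw).mono_left nhdsWithin_le_nhds, ?_⟩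
    filter_upwards [nhdsWithin_le_nhds (h.D_open.mem_nhds hw), self_mem_nhdsWithin] with y hy hne
    intro he
    apply hne
    have : f (qq f y) = f (qq f w) := by rw [he]
    rwa [f_q hy, f_q hw] at this
  filter_upwards [h2.eventually h1, nhdsWithin_le_nhds (h.D_open.mem_nhds hw)] with y hy hyD
  exact (h.q_deriv hyD hy).differentiableAt

theorem Sch.zero_mem (h : Sch f) : (0:ℂ) ∈ f '' Metric.ball 0 1 := ⟨0, by simp, h.zero⟩

theorem Sch.q_zero (h : Sch f) : qq f 0 = 0 := by
  have := h.q_f (z := 0) (by simp)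
  rwa [h.zero] at this

theorem Sch.q_ne (h : Sch f) {w : ℂ} (hw : w ∈ f '' Metric.ball 0 1) (h0 : w ≠ 0) : qq f w ≠ 0 := by
  intro h1
  have := f_q hw
  rw [h1, h.zero] at this
  exact h0 this.symm

theorem Sch.q_der0 (h : Sch f) : HasDerivAt (qq f) 1 0 := by
  have := h.q_deriv h.zero_mem (by rw [h.q_zero, h.der]; exact one_ne_zero)
  simpa [h.q_zero, h.der] using this

open Classical in
noncomputable def uu (f : ℂ → ℂ) (w : ℂ) : ℝ :=
  if w ∈ f '' Metric.ball 0 1 then - Real.log ‖qq f w‖ else 0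

theorem uu_of_mem {w : ℂ} (hw : w ∈ f '' Metric.ball 0 1) : uu f w = - Real.log ‖qq f w‖ := if_pos hw

theorem uu_of_not {w : ℂ} (hw : w ∉ f '' Metric.ball 0 1) : uu f w = 0 := if_neg hw

theorem uu_nonneg (w : ℂ) : 0 ≤ uu f w := by
  by_cases hw : w ∈ f '' Metric.ball 0 1
  · rw [uu_of_mem hw, neg_nonneg]
    have := q_mem hw
    rw [mem_ball_zero_iff] at this
    exact Real.log_nonpos (norm_nonneg _) this.le
  · rw [uu_of_not hw]

theorem Sch.uu_neg (h : Sch f) (w : ℂ) : uu f (-w) = uu f w := by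
  have key : ∀ w, w ∈ f '' Metric.ball 0 1 → -w ∈ f '' Metric.ball 0 1 ∧ uu f (-w) = uu f w := by
    rintro _ ⟨z, hz, rfl⟩
    have hz' : -z ∈ Metric.ball (0:ℂ) 1 := by simpa using hz
    have hm : -f z ∈ f '' Metric.ball 0 1 := ⟨-z, hz', h.odd z hz⟩
    refine ⟨hm, ?_⟩
    rw [uu_of_mem hm, uu_of_mem ⟨z, hz, rfl⟩, ← h.odd z hz, h.q_f hz, h.q_f hz', norm_neg]
  by_cases hw : w ∈ f '' Metric.ball 0 1
  · exact (key w hw).2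
  · rw [uu_of_not hw, uu_of_not]
    intro h1
    have := (key _ h1).1
    rw [neg_neg] at this
    exact hw this

theorem Sch.uu_lt (h : Sch f) {w : ℂ} {τ : ℝ} (hτ : 0 < τ) (h1 : τ < uu f w) :
    ∃ z ∈ Metric.ball (0:ℂ) (Real.exp (-τ)), f z = w := by
  have hw : w ∈ f '' Metric.ball 0 1 := by
    by_contra hw; rw [uu_of_not hw] at h1; linarith
  refine ⟨qq f w, ?_, f_q hw⟩
  rw [uu_of_mem hw] at h1
  rw [mem_ball_zero_iff]
  by_cases h0 : qq f w = 0
  · rw [h0, norm_zero]; positivity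
  · rw [← Real.log_lt_iff_lt_exp (norm_pos_iff.2 h0)]; linarith

theorem Sch.uu_cont (h : Sch f) {w : ℂ} (h0 : w ≠ 0) : ContinuousAt (uu f) w := by
  by_cases hw : w ∈ f '' Metric.ball 0 1
  · have : ContinuousAt (fun w => - Real.log ‖qq f w‖) w :=
      ((h.q_cont hw).norm.log (norm_ne_zero_iff.2 (h.q_ne hw h0))).neg
    refine this.congr ?_
    filter_upwards [h.D_open.mem_nhds hw] with y hy using (uu_of_mem hy).symm
  · rw [ContinuousAt, uu_of_not hw, Metric.tendsto_nhds]
    intro ε hε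
    have hK : IsCompact (f '' Metric.closedBall 0 (Real.exp (-ε / 2))) := by
      refine (isCompact_closedBall _ _).image_of_continuousOn (h.diff.continuousOn.mono ?_)
      exact Metric.closedBall_subset_ball (by rw [Real.exp_lt_one_iff]; linarith)
    have hwK : w ∉ f '' Metric.closedBall 0 (Real.exp (-ε / 2)) := fun hm => hw <| by
      refine image_mono ?_ hm
      exact Metric.closedBall_subset_ball (by rw [Real.exp_lt_one_iff]; linarith)
    filter_upwards [hK.isClosed.isOpen_compl.mem_nhds hwK] with y hy
    rw [Real.dist_eq, sub_zero, abs_of_nonneg (uu_nonneg y)]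
    by_contra hc
    obtain ⟨z, hz, hzy⟩ := h.uu_lt (w := y) (τ := ε / 2) (by linarith) (by linarith)
    exact hy ⟨z, Metric.ball_subset_closedBall (by rwa [neg_div]), hzy⟩

/-- in logarithmic coordinates -/
noncomputable def UU (f : ℂ → ℂ) (x y : ℝ) : ℝ := uu f (Complex.exp (x + y * Complex.I))

theorem Sch.UU_cont (h : Sch f) : Continuous (Function.uncurry (UU f)) := by
  rw [continuous_iff_continuousAt]
  intro p
  have : ContinuousAt (fun p : ℝ × ℝ => Complex.exp (p.1 + p.2 * Complex.I)) p := by fun_prop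
  exact ContinuousAt.comp (f := fun p : ℝ × ℝ => Complex.exp (p.1 + p.2 * Complex.I))
    (h.uu_cont (Complex.exp_ne_zero _)) this

theorem Sch.UU_per (h : Sch f) (x y : ℝ) : UU f x (y + π) = UU f x y := by
  unfold UU
  rw [← h.uu_neg]
  congr 1
  push_cast
  rw [show (x:ℂ) + (y + π) * Complex.I = x + y * Complex.I + π * Complex.I by ring, Complex.exp_add,
    Complex.exp_pi_mul_I]
  ring

theorem UU_nonneg (x y : ℝ) : 0 ≤ UU f x y := uu_nonneg _

end BStar


namespace BStar
variable {f : ℂ → ℂ}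

theorem Sch.mv (h : Sch f) {x y r : ℝ} (hr : 0 < r)
    (hD : ∀ ζ ∈ Metric.closedBall ((x:ℂ) + y * Complex.I) r,
      Complex.exp ζ ∈ f '' Metric.ball 0 1) :
    ∫ φ in (0:ℝ)..(2 * π), UU f (x + r * cos φ) (y + r * sin φ) = 2 * π * UU f x y := by
  have H : InnerProductSpace.HarmonicOnNhd (fun ζ => Real.log ‖qq f (Complex.exp ζ)‖)
      (Metric.closedBall ((x:ℂ) + y * Complex.I) |r|) := by
    intro ζ hζ
    rw [abs_of_pos hr] at hζ
    exact AnalyticAt.harmonicAt_log_norm (f := fun ζ => qq f (Complex.exp ζ))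
      ((h.q_an (hD ζ hζ)).fun_comp analyticAt_cexp) (h.q_ne (hD ζ hζ) (Complex.exp_ne_zero _))
  have e := H.circleAverage_eq
  rw [Real.circleAverage_def, smul_eq_mul] at e
  have e2 : ∫ φ in (0:ℝ)..(2 * π), UU f (x + r * cos φ) (y + r * sin φ) =
      ∫ φ in (0:ℝ)..(2 * π), - Real.log ‖qq f (Complex.exp (circleMap ((x:ℂ) + y * Complex.I) r φ))‖ := by
    refine intervalIntegral.integral_congr fun φ _ => ?_
    have e3 : ((x + r * cos φ : ℝ) : ℂ) + (y + r * sin φ : ℝ) * Complex.I =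
        circleMap ((x:ℂ) + y * Complex.I) r φ := by
      rw [circleMap, Complex.exp_mul_I]; push_cast; ring
    simp only [UU, e3]
    exact uu_of_mem (hD _ (circleMap_mem_closedBall _ hr.le _))
  rw [e2, intervalIntegral.integral_neg, UU, uu_of_mem (hD _ (Metric.mem_closedBall_self hr.le)), ← e]
  field_simp

/-- truncation -/
noncomputable def WW (f : ℂ → ℂ) (τ x y : ℝ) : ℝ := max (UU f x y - τ) 0

theorem WW_nonneg (τ x y : ℝ) : 0 ≤ WW f τ x y := le_max_right _ _

theorem WW_ge (τ x y : ℝ) : UU f x y - τ ≤ WW f τ x y := le_max_left _ _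

theorem Sch.WW_cont (h : Sch f) (τ : ℝ) : Continuous (Function.uncurry (WW f τ)) :=
  (h.UU_cont.sub continuous_const).max continuous_const

theorem Sch.WW_per (h : Sch f) (τ x y : ℝ) : WW f τ x (y + π) = WW f τ x y := by
  unfold WW; rw [h.UU_per]

theorem Sch.WW_pos (h : Sch f) {τ x y : ℝ} (hτ : 0 < τ) (hp : 0 < WW f τ x y) :
    ∃ z ∈ Metric.ball (0:ℂ) (Real.exp (-τ)), f z = Complex.exp (x + y * Complex.I) := by
  refine h.uu_lt hτ ?_
  unfold WW at hp
  rcases lt_max_iff.1 hp with h1 | h1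
  · unfold UU at h1; linarith
  · exact absurd h1 (lt_irrefl _)

theorem WW_eq_of_pos {τ x y : ℝ} (hp : 0 < WW f τ x y) : WW f τ x y = UU f x y - τ := by
  unfold WW at hp ⊢
  rcases lt_max_iff.1 hp with h1 | h1
  · exact max_eq_left h1.le
  · exact absurd h1 (lt_irrefl _)

theorem Sch.compact (h : Sch f) {τ : ℝ} (hτ : 0 < τ) :
    IsCompact (f '' Metric.closedBall 0 (Real.exp (-τ))) := by
  refine (isCompact_closedBall _ _).image_of_continuousOn (h.diff.continuousOn.mono ?_)
  exact Metric.closedBall_subset_ball (by rw [Real.exp_lt_one_iff]; linarith)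

theorem ball_sub {τ : ℝ} (hτ : 0 < τ) :
    Metric.closedBall (0:ℂ) (Real.exp (-τ)) ⊆ Metric.ball 0 1 :=
  Metric.closedBall_subset_ball (by rw [Real.exp_lt_one_iff]; linarith)

theorem Sch.submean (h : Sch f) {τ : ℝ} (hτ : 0 < τ) : ∃ h0 > 0, ∀ r, 0 < r → r < h0 → ∀ x y,
    2 * π * WW f τ x y ≤ ∫ φ in (0:ℝ)..(2 * π), WW f τ (x + r * cos φ) (y + r * sin φ) := by
  have hK := h.compact hτ
  obtain ⟨δ, hδ, hδK⟩ := hK.exists_thickening_subset_open h.D_open (image_mono (ball_sub hτ))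
  obtain ⟨M, hM⟩ := hK.isBounded.exists_norm_le
  have hM0 : 0 ≤ M := (norm_nonneg _).trans (hM (f 0) ⟨0, by simp; positivity, rfl⟩)
  refine ⟨min 1 (δ / (2 * (M + 1))), by positivity, fun r hr hr2 x y => ?_⟩
  have hr1 : r < 1 := hr2.trans_le (min_le_left _ _)
  have hr3 : r < δ / (2 * (M + 1)) := hr2.trans_le (min_le_right _ _)
  rw [lt_div_iff₀ (by positivity)] at hr3
  have hc := h.WW_cont τ
  have hcc : Continuous fun φ : ℝ => WW f τ (x + r * cos φ) (y + r * sin φ) :=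
    hc.comp ((by fun_prop : Continuous fun φ => x + r * cos φ).prodMk (by fun_prop :
      Continuous fun φ => y + r * sin φ))
  have hcu : Continuous fun φ : ℝ => UU f (x + r * cos φ) (y + r * sin φ) :=
    h.UU_cont.comp ((by fun_prop : Continuous fun φ => x + r * cos φ).prodMk (by fun_prop :
      Continuous fun φ => y + r * sin φ))
  rcases (WW_nonneg (f := f) τ x y).eq_or_lt with h0 | h0
  · rw [← h0, mul_zero]
    exact intervalIntegral.integral_nonneg (by positivity) fun _ _ => WW_nonneg _ _ _
  · obtain ⟨z, hz, hzw⟩ := h.WW_pos hτ h0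
    have hm := h.mv (x := x) (y := y) hr (fun ζ hζ => by
      apply hδK
      rw [Metric.mem_thickening_iff]
      refine ⟨_, ⟨z, Metric.ball_subset_closedBall hz, rfl⟩, ?_⟩
      have hb := hM (f z) ⟨z, Metric.ball_subset_closedBall hz, rfl⟩
      rw [hzw] at hb ⊢
      set c := (x:ℂ) + y * Complex.I
      rw [Metric.mem_closedBall, dist_eq_norm] at hζ
      rw [dist_eq_norm, show Complex.exp ζ - Complex.exp c = Complex.exp c * (Complex.exp (ζ - c) - 1) by
        rw [mul_sub, ← Complex.exp_add]; ring_nf, norm_mul]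
      have h2 := Complex.norm_exp_sub_one_le (x := ζ - c) (by linarith)
      calc _ ≤ M * (2 * ‖ζ - c‖) := by gcongr
        _ ≤ M * (2 * r) := by gcongr
        _ < δ := by nlinarith)
    rw [WW_eq_of_pos h0]
    calc 2 * π * (UU f x y - τ) = ∫ φ in (0:ℝ)..(2 * π), (UU f (x + r * cos φ) (y + r * sin φ) - τ) := by
          rw [intervalIntegral.integral_sub (hcu.intervalIntegrable _ _) (by simp), hm]
          simp; ring
      _ ≤ _ := intervalIntegral.integral_mono (by positivity)
          ((hcu.sub continuous_const).intervalIntegrable _ _)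
          (hcc.intervalIntegrable _ _) fun φ => WW_ge _ _ _

theorem Sch.right (h : Sch f) {τ : ℝ} (hτ : 0 < τ) : ∃ X, ∀ x, X ≤ x → ∀ y, WW f τ x y = 0 := by
  obtain ⟨M, hM⟩ := (h.compact hτ).isBounded.exists_norm_le
  have hM0 : 0 ≤ M := (norm_nonneg _).trans (hM (f 0) ⟨0, by simp; positivity, rfl⟩)
  refine ⟨Real.log (M + 1), fun x hx y => ?_⟩
  by_contra hne
  obtain ⟨z, hz, hzw⟩ := h.WW_pos hτ (lt_of_le_of_ne (WW_nonneg (f := f) τ x y) (Ne.symm hne))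
  have hb := hM (f z) ⟨z, Metric.ball_subset_closedBall hz, rfl⟩
  rw [hzw, Complex.norm_exp] at hb
  simp at hb
  rw [Real.log_le_iff_le_exp (by linarith)] at hx
  linarith

theorem Sch.asymp (h : Sch f) {ε : ℝ} (hε : 0 < ε) :
    ∃ X, ∀ x, x ≤ -X → ∀ y, |UU f x y + x| ≤ ε := by
  have h1 : Tendsto (fun w => w⁻¹ * qq f w) (𝓝[≠] 0) (𝓝 1) := by
    have := h.q_der0.tendsto_slope_zero
    simpa [h.q_zero] using this
  have h2 : Tendsto (fun w => Real.log ‖w⁻¹ * qq f w‖) (𝓝[≠] 0) (𝓝 0) := by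
    have := (h1.norm).log (by simp)
    simpa using this
  have h3 := (Metric.tendsto_nhds.1 h2 ε hε).and (nhdsWithin_le_nhds (h.D_open.mem_nhds h.zero_mem))
  rw [eventually_nhdsWithin_iff, Metric.eventually_nhds_iff] at h3
  obtain ⟨ρ, hρ, hb⟩ := h3
  refine ⟨-(Real.log ρ - 1), fun x hx y => ?_⟩
  have hn : ‖Complex.exp (x + y * Complex.I)‖ = Real.exp x := by
    rw [Complex.norm_exp]; simp
  have := hb (y := Complex.exp (x + y * Complex.I)) (by
    rw [dist_zero_right, hn, ← Real.lt_log_iff_exp_lt hρ]; linarith) (Complex.exp_ne_zero _)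
  obtain ⟨ha, hD⟩ := this
  rw [UU, uu_of_mem hD]
  rw [Real.dist_eq, sub_zero, norm_mul, norm_inv, hn, Real.log_mul (by positivity)
    (norm_ne_zero_iff.2 (h.q_ne hD (Complex.exp_ne_zero _))), Real.log_inv, Real.log_exp] at ha

  have : -Real.log ‖qq f (Complex.exp (x + y * Complex.I))‖ + x =
    -(-x + Real.log ‖qq f (Complex.exp (x + y * Complex.I))‖) := by ring
  rw [this, abs_neg]
  exact ha.le

end BStar


namespace BStar
variable {f : ℂ → ℂ}

theorem circle_pt (x : ℝ) {w : ℂ} (hw : ‖w‖ = Real.exp x) :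
    ∃ y : ℝ, Complex.exp (x + y * Complex.I) = w := by
  refine ⟨w.arg, ?_⟩
  rw [Complex.exp_add, ← Complex.ofReal_exp, ← hw]
  exact Complex.norm_mul_exp_arg_mul_I w

theorem norm_exp_xy (x y : ℝ) : ‖Complex.exp (x + y * Complex.I)‖ = Real.exp x := by
  rw [Complex.norm_exp]; simp

theorem Sch.disc (h : Sch f) {τ x : ℝ} (hτ : 0 < τ) (hp : ∀ y, 0 < WW f τ x y) :
    Metric.closedBall 0 (Real.exp x) ⊆ f '' Metric.ball 0 1 := by
  set s := Real.exp (-τ) with hs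
  have hs0 : 0 < s := Real.exp_pos _
  have hsub := ball_sub hτ
  have hcirc : ∀ w : ℂ, ‖w‖ = Real.exp x → ∃ z ∈ Metric.ball (0:ℂ) s, f z = w := by
    intro w hw
    obtain ⟨y, rfl⟩ := circle_pt x hw
    exact h.WW_pos hτ (hp y)
  have hne : ∀ z ∈ Metric.sphere (0:ℂ) s, ‖f z‖ ≠ Real.exp x := by
    intro z hz hc
    obtain ⟨z', hz', he⟩ := hcirc _ hc
    have := h.inj (hsub (Metric.ball_subset_closedBall hz')) (hsub (Metric.sphere_subset_closedBall hz)) he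
    subst this
    simp at hz hz'
    linarith
  have hcS : ContinuousOn (fun z => ‖f z‖) (Metric.sphere (0:ℂ) s) :=
    (h.diff.continuousOn.mono (Metric.sphere_subset_closedBall.trans hsub)).norm
  have hconn : IsPreconnected (Metric.sphere (0:ℂ) s) :=
    isPreconnected_sphere (by rw [Complex.rank_real_complex]; norm_num) 0 s
  have hS0 : (s : ℂ) ∈ Metric.sphere (0:ℂ) s := by simp [abs_of_pos hs0]
  have hbig : ∀ z ∈ Metric.sphere (0:ℂ) s, Real.exp x < ‖f z‖ := by
    by_contra hc
    push Not at hc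
    obtain ⟨z1, hz1, hz1'⟩ := hc
    have hsmall : ∀ z ∈ Metric.sphere (0:ℂ) s, ‖f z‖ < Real.exp x := by
      intro z hz
      by_contra hc
      obtain ⟨z2, hz2, he⟩ := hconn.intermediate_value hz1 hz hcS ⟨hz1', not_lt.1 hc⟩
      exact hne z2 hz2 he
    obtain ⟨zm, hzm, hmax⟩ := (isCompact_sphere (0:ℂ) s).exists_isMaxOn ⟨_, hS0⟩ hcS
    obtain ⟨z', hz', he⟩ := hcirc (Real.exp x : ℂ) (by
      rw [Complex.norm_real, Real.norm_of_nonneg (Real.exp_pos _).le])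
    have hd : DiffContOnCl ℂ f (Metric.ball 0 s) := by
      refine (h.diff.mono ?_).diffContOnCl
      rw [closure_ball _ hs0.ne']
      exact hsub
    have := Complex.norm_le_of_forall_mem_frontier_norm_le Metric.isBounded_ball hd
      (C := ‖f zm‖) (fun z hz => hmax (by rwa [frontier_ball _ hs0.ne'] at hz)) (subset_closure hz')
    rw [he, Complex.norm_real, Real.norm_of_nonneg (Real.exp_pos _).le] at this
    linarith [hsmall zm hzm]
  intro w hw
  rw [mem_closedBall_zero_iff] at hw
  rcases hw.eq_or_lt with hw | hw
  · obtain ⟨z, hz, rfl⟩ := hcirc w hw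
    exact ⟨z, hsub (Metric.ball_subset_closedBall hz), rfl⟩
  · have hu : IsOpen (f '' Metric.ball 0 s) :=
      h.image_open Metric.isOpen_ball (Metric.ball_subset_closedBall.trans hsub)
    have hv : IsOpen (f '' Metric.closedBall 0 s)ᶜ := (h.compact hτ).isClosed.isOpen_compl
    have := (convex_ball (0:ℂ) (Real.exp x)).isPreconnected.subset_left_of_subset_union hu hv
      (disjoint_compl_right.mono_left (image_mono Metric.ball_subset_closedBall)) (by
        intro w hw
        by_cases hm : w ∈ f '' Metric.closedBall 0 s
        · left
          obtain ⟨z, hz, rfl⟩ := hm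
          refine ⟨z, ?_, rfl⟩
          rw [mem_closedBall_zero_iff] at hz
          rw [mem_ball_zero_iff] at hw ⊢
          refine lt_of_le_of_ne hz fun he => ?_
          have := hbig z (by simpa using he)
          linarith
        · right; exact hm)
      ⟨0, by simp [Real.exp_pos], 0, by simp [hs0], h.zero⟩
    have hw2 := this (mem_ball_zero_iff.2 hw)
    exact image_mono (Metric.ball_subset_closedBall.trans hsub) hw2

theorem Sch.mean (h : Sch f) {x : ℝ} (hsub : Metric.closedBall 0 (Real.exp x) ⊆ f '' Metric.ball 0 1) :
    ∫ t in (0:ℝ)..π, UU f x t = - (π * x) := by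
  have hR := Real.exp_pos x
  have hdq : DifferentiableOn ℂ (dslope (qq f) 0) (f '' Metric.ball 0 1) := by
    rw [Complex.differentiableOn_dslope (h.D_open.mem_nhds h.zero_mem)]
    exact fun w hw => (h.q_an hw).differentiableAt.differentiableWithinAt
  have hd0 : dslope (qq f) 0 0 = 1 := by rw [dslope_same]; exact h.q_der0.deriv
  have hdn : ∀ w ≠ 0, dslope (qq f) 0 w = w⁻¹ * qq f w := fun w hw => by
    rw [dslope_of_ne _ hw, slope_def_field, h.q_zero]; simp [div_eq_inv_mul]
  have H : InnerProductSpace.HarmonicOnNhd (fun w => Real.log ‖dslope (qq f) 0 w‖)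
      (Metric.closedBall 0 |Real.exp x|) := by
    intro w hw
    rw [abs_of_pos hR] at hw
    refine AnalyticAt.harmonicAt_log_norm (hdq.analyticAt (h.D_open.mem_nhds (hsub hw))) ?_
    by_cases h0 : w = 0
    · rw [h0, hd0]; exact one_ne_zero
    · rw [hdn w h0]; exact mul_ne_zero (inv_ne_zero h0) (h.q_ne (hsub hw) h0)
  have e := H.circleAverage_eq
  rw [Real.circleAverage_def, smul_eq_mul, hd0] at e
  have hc := cont_slice h.UU_cont x
  have e2 : ∫ φ in (0:ℝ)..(2 * π), Real.log ‖dslope (qq f) 0 (circleMap 0 (Real.exp x) φ)‖ =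
      ∫ φ in (0:ℝ)..(2 * π), (- x - UU f x φ) := by
    refine intervalIntegral.integral_congr fun φ _ => ?_
    have e3 : circleMap 0 (Real.exp x) φ = Complex.exp (x + φ * Complex.I) := by
      rw [circleMap, Complex.exp_add, Complex.ofReal_exp]; simp
    have hm : Complex.exp (x + φ * Complex.I) ∈ f '' Metric.ball 0 1 :=
      hsub (by rw [mem_closedBall_zero_iff, norm_exp_xy])
    simp only [e3]
    rw [hdn _ (Complex.exp_ne_zero _), norm_mul, norm_inv, norm_exp_xy, Real.log_mul (by positivity)
      (norm_ne_zero_iff.2 (h.q_ne hm (Complex.exp_ne_zero _))), Real.log_inv, Real.log_exp, UU,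
      uu_of_mem hm]
    ring
  rw [e2, intervalIntegral.integral_sub (by simp) (hc.intervalIntegrable _ _)] at e
  have hper : Function.Periodic (UU f x) π := h.UU_per x
  have e4 : ∫ φ in (0:ℝ)..(2 * π), UU f x φ = 2 * ∫ t in (0:ℝ)..π, UU f x t := by
    rw [← intervalIntegral.integral_add_adjacent_intervals (hc.intervalIntegrable 0 π)
      (hc.intervalIntegrable π (2 * π))]
    have := hper.intervalIntegral_add_eq π 0
    rw [zero_add, ← two_mul] at this
    rw [this]; ring
  rw [e4] at e
  rw [intervalIntegral.integral_const, smul_eq_mul, norm_one, Real.log_one, mul_eq_zero] at e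
  rcases e with e | e
  · exact absurd e (inv_ne_zero (by positivity))
  · linarith

theorem conv_nonneg {d : ℝ → ℝ} (hd : Continuous d) {h0 : ℝ} (hh0 : 0 < h0)
    (sub : ∀ r, 0 < r → r < h0 → ∀ x, 2 * π * d x ≤ ∫ φ in (0:ℝ)..(2 * π), d (x + r * cos φ))
    (A : ℝ) (hA : ∀ x ≤ A, d x = 0) (x1 : ℝ) : 0 ≤ d x1 := by
  by_contra hneg
  push Not at hneg
  have hx1 : A < x1 := by
    by_contra hc
    rw [hA x1 (not_lt.1 hc)] at hneg
    exact lt_irrefl _ hneg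
  set L := x1 - A with hL
  have hL0 : 0 < L := by linarith
  obtain ⟨c, hc, hc1⟩ : ∃ c > 0, d x1 + c * (L + L ^ 2) < 0 := by
    refine ⟨-d x1 / (2 * (L + L ^ 2)), div_pos (by linarith) (by positivity), ?_⟩
    have : -d x1 / (2 * (L + L ^ 2)) * (L + L ^ 2) = - d x1 / 2 := by field_simp
    rw [this]; linarith
  set g : ℝ → ℝ := fun x => d x + (c * (x - A) + c / 2 * (x - A) ^ 2) with hg
  have hgc : Continuous g := by fun_prop
  obtain ⟨m, hm, hmax⟩ := (isCompact_Icc (a := A - 1) (b := x1)).exists_isMaxOn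
    (nonempty_Icc.2 (by linarith)) hgc.continuousOn
  have hgA : g A = 0 := by simp [hg, hA A le_rfl]
  have hgm : 0 ≤ g m := by rw [← hgA]; exact hmax ⟨by linarith, hx1.le⟩
  have hg1 : g (A - 1) < 0 := by
    simp only [hg, hA (A - 1) (by linarith)]; ring_nf; linarith
  have hg2 : g x1 < 0 := by
    simp only [hg, ← hL]
    have : 0 < c * L ^ 2 := by positivity
    nlinarith
  have hm1 : A - 1 < m := lt_of_le_of_ne hm.1 fun he => by rw [← he] at hgm; linarith
  have hm2 : m < x1 := lt_of_le_of_ne hm.2 fun he => by rw [he] at hgm; linarith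
  obtain ⟨r, hr, hr0, hr1, hr2⟩ : ∃ r > 0, r < h0 ∧ r ≤ m - (A - 1) ∧ r ≤ x1 - m := by
    refine ⟨min (h0 / 2) (min (m - (A - 1)) (x1 - m)), ?_, ?_, ?_, ?_⟩
    · exact lt_min (by linarith) (lt_min (by linarith) (by linarith))
    · exact (min_le_left _ _).trans_lt (by linarith)
    · exact (min_le_right _ _).trans (min_le_left _ _)
    · exact (min_le_right _ _).trans (min_le_right _ _)
  have hle : ∀ φ, g (m + r * cos φ) ≤ g m := by
    intro φ
    have h1 : r * cos φ ≤ r := mul_le_of_le_one_right hr.le (cos_le_one φ)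
    have h2 : -r ≤ r * cos φ := by nlinarith [neg_one_le_cos φ]
    exact hmax ⟨by linarith, by linarith⟩
  have I1 : ∫ φ in (0:ℝ)..(2 * π), g (m + r * cos φ) ≤ 2 * π * g m := by
    calc _ ≤ ∫ φ in (0:ℝ)..(2 * π), g m :=
          intervalIntegral.integral_mono (by positivity)
            (Continuous.intervalIntegrable (hgc.comp (by fun_prop)) _ _) (by simp) hle
      _ = _ := by simp
  have I2 : ∫ φ in (0:ℝ)..(2 * π), (c * (m + r * cos φ - A) + c / 2 * (m + r * cos φ - A) ^ 2) =
      2 * π * (c * (m - A) + c / 2 * (m - A) ^ 2) + c / 2 * r ^ 2 * π := by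
    have : ∀ φ, c * (m + r * cos φ - A) + c / 2 * (m + r * cos φ - A) ^ 2 =
      (c * (m - A) + c / 2 * (m - A) ^ 2) + ((c * r + c * (m - A) * r) * cos φ +
        (c / 2 * r ^ 2) * cos φ ^ 2) := by intro φ; ring
    simp_rw [this]
    have j1 : ∫ φ in (0:ℝ)..(2 * π), (c * r + c * (m - A) * r) * cos φ = 0 := by
      rw [intervalIntegral.integral_const_mul, integral_cos]; simp
    have j2 : ∫ φ in (0:ℝ)..(2 * π), (c / 2 * r ^ 2) * cos φ ^ 2 = c / 2 * r ^ 2 * π := by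
      rw [intervalIntegral.integral_const_mul, integral_cos_sq]; simp
    generalize c * (m - A) + c / 2 * (m - A) ^ 2 = K0
    rw [intervalIntegral.integral_add (by simp), intervalIntegral.integral_add, j1, j2,
      intervalIntegral.integral_const]
    · simp
    all_goals exact Continuous.intervalIntegrable (by fun_prop) _ _
  simp only [hg] at I1
  rw [intervalIntegral.integral_add, I2] at I1
  · have := sub r hr hr0 m
    have : 0 < c / 2 * r ^ 2 * π := by positivity
    nlinarith
  · exact Continuous.intervalIntegrable (hd.comp (by fun_prop)) _ _
  · exact Continuous.intervalIntegrable (by fun_prop) _ _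

theorem Sch.WW_eq (h : Sch f) {τ : ℝ} (hτ : 0 < τ) {x : ℝ} (hp : ∀ y, 0 < WW f τ x y) :
    ∫ t in (0:ℝ)..π, WW f τ x t = - (π * (x + τ)) := by
  simp_rw [WW_eq_of_pos (hp _)]
  rw [intervalIntegral.integral_sub ((cont_slice h.UU_cont x).intervalIntegrable _ _) (by simp),
    h.mean (h.disc hτ hp)]
  simp; ring

theorem Sch.lower (h : Sch f) {τ : ℝ} (hτ : 0 < τ) (x : ℝ) :
    - (π * (x + τ)) ≤ ∫ t in (0:ℝ)..π, WW f τ x t := by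
  obtain ⟨h0, hh0, hs⟩ := h.submean hτ
  obtain ⟨X, hX⟩ := h.asymp one_pos
  have hc := h.WW_cont τ
  have hcG : Continuous fun x => ∫ t in (0:ℝ)..π, WW f τ x t :=
    (cont_G hc).comp (continuous_id.prodMk continuous_const)
  have key := conv_nonneg (d := fun x => (∫ t in (0:ℝ)..π, WW f τ x t) + π * (x + τ))
    (by fun_prop) hh0 ?_ (min (-X) (-2 - τ)) ?_ x
  · linarith
  · intro r hr hr0 x
    have cW2 : Continuous (Function.uncurry fun t φ => WW f τ (x + r * cos φ) (t + r * sin φ)) :=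
      hc.comp ((by fun_prop : Continuous fun q : ℝ × ℝ => x + r * cos q.2).prodMk
        (by fun_prop : Continuous fun q : ℝ × ℝ => q.1 + r * sin q.2))
    have i1 : 2 * π * ∫ t in (0:ℝ)..π, WW f τ x t ≤
        ∫ φ in (0:ℝ)..(2 * π), ∫ t in (0:ℝ)..π, WW f τ (x + r * cos φ) t := by
      calc 2 * π * ∫ t in (0:ℝ)..π, WW f τ x t = ∫ t in (0:ℝ)..π, 2 * π * WW f τ x t := by
            rw [intervalIntegral.integral_const_mul]
        _ ≤ ∫ t in (0:ℝ)..π, ∫ φ in (0:ℝ)..(2 * π), WW f τ (x + r * cos φ) (t + r * sin φ) := by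
            refine intervalIntegral.integral_mono pi_pos.le
              (Continuous.intervalIntegrable (continuous_const.mul (cont_slice hc x)) _ _)
              (Continuous.intervalIntegrable
                (intervalIntegral.continuous_parametric_intervalIntegral_of_continuous' cW2 _ _) _ _)
              fun t => hs r hr hr0 x t
        _ = ∫ φ in (0:ℝ)..(2 * π), ∫ t in (0:ℝ)..π, WW f τ (x + r * cos φ) (t + r * sin φ) := by
            refine intervalIntegral_intervalIntegral_swap ?_
            exact (cW2.continuousOn.integrableOn_compact
              (isCompact_uIcc.prod isCompact_uIcc)).mono_set
              (Set.prod_mono uIoc_subset_uIcc uIoc_subset_uIcc)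
        _ = _ := by
            refine intervalIntegral.integral_congr fun φ _ => ?_
            have hper : Function.Periodic (WW f τ (x + r * cos φ)) π := h.WW_per τ _
            rw [intervalIntegral.integral_comp_add_right (fun t => WW f τ (x + r * cos φ) t), zero_add,
              add_comm π, hper.intervalIntegral_add_eq _ 0, zero_add]
    rw [intervalIntegral.integral_add]
    · have i2 : ∫ φ in (0:ℝ)..(2 * π), π * (x + r * cos φ + τ) = 2 * π * (π * (x + τ)) := by
        have : ∀ φ, π * (x + r * cos φ + τ) = π * (x + τ) + (π * r) * cos φ := by intro φ; ring
        simp_rw [this]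
        rw [intervalIntegral.integral_add (by simp)
          (Continuous.intervalIntegrable (by fun_prop) _ _),
          intervalIntegral.integral_const_mul (π * r), integral_cos]
        simp; ring
      rw [i2]; linarith
    · exact Continuous.intervalIntegrable (hcG.comp (by fun_prop)) _ _
    · exact Continuous.intervalIntegrable (by fun_prop) _ _
  · intro x hx
    have h1 := hx.trans (min_le_left _ _)
    have h2 := hx.trans (min_le_right _ _)
    have hp : ∀ y, 0 < WW f τ x y := by
      intro y
      have := (abs_le.1 (hX x h1 y)).1
      exact lt_of_lt_of_le (by linarith) (WW_ge τ x y)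
    rw [h.WW_eq hτ hp]; ring

end BStar


namespace BStar
variable {f : ℂ → ℂ}

noncomputable def kk (z : ℂ) : ℂ := z / (1 - z ^ 2)

theorem one_sub_ne {z : ℂ} (hz : z ∈ Metric.ball (0:ℂ) 1) : 1 - z ^ 2 ≠ 0 := by
  intro h
  have : z ^ 2 = 1 := by linear_combination -h
  have h2 : ‖z‖ ^ 2 = 1 := by rw [← norm_pow, this, norm_one]
  rw [mem_ball_zero_iff] at hz
  nlinarith [norm_nonneg z]

theorem sch_kk : Sch kk where
  diff := by
    intro z hz
    have := one_sub_ne hz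
    have h2 : DifferentiableAt ℂ (fun z : ℂ => z / (1 - z ^ 2)) z := by
      fun_prop (disch := assumption)
    exact h2.differentiableWithinAt
  inj := by
    intro z hz w hw he
    have h1 := one_sub_ne hz
    have h2 := one_sub_ne hw
    unfold kk at he
    rw [div_eq_div_iff h1 h2] at he
    have h3 : (z - w) * (1 + z * w) = 0 := by linear_combination he
    rcases mul_eq_zero.1 h3 with h | h
    · exact sub_eq_zero.1 h
    · exfalso
      have : z * w = -1 := by linear_combination h
      have h4 : ‖z‖ * ‖w‖ = 1 := by rw [← norm_mul, this]; simp
      rw [mem_ball_zero_iff] at hz hw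
      nlinarith [norm_nonneg z, norm_nonneg w]
  odd := by intro z _; unfold kk; rw [neg_sq, neg_div]
  der := by
    have : HasDerivAt kk ((1 * (1 - (0:ℂ) ^ 2) - 0 * (-(2 * 0 ^ 1 * 1))) / (1 - 0 ^ 2) ^ 2) 0 := by
      unfold kk
      refine (hasDerivAt_id (0:ℂ)).div ?_ (by simp)
      simpa using ((hasDerivAt_id (0:ℂ)).pow 2).const_sub 1
    simpa using this.deriv

theorem half_plane {w : ℂ} (hw : 0 < w.re) : w ∈ kk '' Metric.ball 0 1 := by
  have hw0 : w ≠ 0 := by rintro rfl; simp at hw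
  obtain ⟨s, hs⟩ := IsAlgClosed.exists_pow_nat_eq (1 + 4 * w ^ 2) (n := 2) (by norm_num)
  have root : ∀ z : ℂ, w * z ^ 2 + z - w = 0 → ‖z‖ < 1 → w ∈ kk '' Metric.ball 0 1 := by
    intro z hz hlt
    have hm : z ∈ Metric.ball (0:ℂ) 1 := by simpa using hlt
    refine ⟨z, hm, ?_⟩
    unfold kk
    rw [div_eq_iff (one_sub_ne hm)]
    linear_combination hz
  have hne : ∀ z : ℂ, w * z ^ 2 + z - w = 0 → ‖z‖ ≠ 1 := by
    intro z hz h1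
    have hn : Complex.normSq z = 1 := by rw [Complex.normSq_eq_norm_sq, h1]; norm_num
    have hc : z * (starRingEnd ℂ) z = 1 := by rw [Complex.mul_conj, hn]; norm_num
    -- divide by z
    have h2 : w * (z - (starRingEnd ℂ) z) = -1 := by
      have hz0 : z ≠ 0 := by rintro rfl; simp at h1
      apply mul_right_cancel₀ hz0
      linear_combination hz - w * hc
    have h3 := congrArg Complex.im h2
    have h4 := congrArg Complex.re h2
    simp [Complex.mul_re, Complex.mul_im] at h3 h4
    rcases h3 with h3 | h3
    · linarith
    · have : z.im = 0 := by linarith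
      rw [this] at h4; simp at h4
  set z1 := (-1 + s) / (2 * w) with hz1
  set z2 := (-1 - s) / (2 * w) with hz2
  have r1 : w * z1 ^ 2 + z1 - w = 0 := by
    rw [hz1]; field_simp; linear_combination hs
  have r2 : w * z2 ^ 2 + z2 - w = 0 := by
    rw [hz2]; field_simp; linear_combination hs
  have hprod : z1 * z2 = -1 := by
    rw [hz1, hz2]; field_simp; linear_combination -hs
  have hnp : ‖z1‖ * ‖z2‖ = 1 := by rw [← norm_mul, hprod]; simp
  rcases lt_or_gt_of_ne (hne z1 r1) with h | h
  · exact root z1 r1 h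
  · refine root z2 r2 ?_
    by_contra hc
    push Not at hc
    nlinarith

theorem kk_mv (x y h : ℝ) (hh : 0 < h) (hy : |y| + h < π / 2) :
    ∫ φ in (0:ℝ)..(2 * π), UU kk (x + h * cos φ) (y + h * sin φ) = 2 * π * UU kk x y := by
  refine sch_kk.mv hh fun ζ hζ => half_plane ?_
  rw [Complex.exp_re]
  refine mul_pos (Real.exp_pos _) (cos_pos_of_mem_Ioo ?_)
  rw [Metric.mem_closedBall, dist_eq_norm] at hζ
  have h1 := (Complex.abs_im_le_norm (ζ - (x + y * Complex.I))).trans hζ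
  simp at h1
  have h2 := abs_le.1 h1
  have h3 := abs_lt.1 (show |y| < π / 2 - h by linarith)
  constructor <;> linarith

theorem Sch.compare (h : Sch f) {τ : ℝ} (hτ : 0 < τ) (n : ℕ) (p : ℕ → ℝ) (hp : Cfg n p) (x : ℝ) :
    alt (G (WW f τ) x) n p ≤ Vs (UU kk) x (alt id n p / 2) := by
  obtain ⟨h0, hh0, hs⟩ := h.submean hτ
  obtain ⟨X1, hX1⟩ := h.right hτ
  obtain ⟨X2, hX2⟩ := h.asymp (half_pos hτ)
  obtain ⟨X3, hX3⟩ := sch_kk.asymp (half_pos hτ)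
  refine star (h.WW_cont τ) sch_kk.UU_cont (WW_nonneg τ) UU_nonneg (h.WW_per τ) hh0 hs kk_mv
    (max X1 (max X2 X3)) (fun x hx => hX1 x ((le_max_left _ _).trans hx)) ?_ ?_ n p hp x
  · intro x hx y y'
    have m1 := (le_max_left X2 X3).trans (le_max_right X1 _)
    have m2 := (le_max_right X2 X3).trans (le_max_right X1 _)
    have a1 := (abs_le.1 (hX2 x (by linarith) y)).2
    have a2 := (abs_le.1 (hX3 x (by linarith) y')).1
    exact max_le (by linarith) (UU_nonneg _ _)
  · intro x hx
    rw [h.WW_eq hτ hx]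
    refine (sch_kk.lower hτ x).trans ?_
    have hper : Function.Periodic (UU kk x) π := sch_kk.UU_per x
    have e : Vs (UU kk) x (π / 2) = ∫ t in (0:ℝ)..π, UU kk x t := by
      have := hper.intervalIntegral_add_eq (-(π / 2)) 0
      rw [show -(π / 2) + π = π / 2 by ring, zero_add] at this
      exact this
    rw [e]
    refine intervalIntegral.integral_mono pi_pos.le
      ((cont_slice (sch_kk.WW_cont τ) x).intervalIntegrable _ _)
      ((cont_slice sch_kk.UU_cont x).intervalIntegrable _ _) fun t => ?_
    exact max_le (by linarith) (UU_nonneg _ _)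

theorem Sch.compare0 (h : Sch f) (n : ℕ) (p : ℕ → ℝ) (hp : Cfg n p) (x : ℝ) :
    alt (G (UU f) x) n p ≤ Vs (UU kk) x (alt id n p / 2) := by
  refine le_of_forall_pos_le_add fun ε hε => ?_
  have hτ : 0 < ε / π := by positivity
  have h1 := h.compare hτ n p hp x
  have h2 : alt (G (UU f) x) n p ≤ alt (G (WW f (ε / π)) x) n p + ε / π * alt id n p := by
    rw [alt_G h.UU_cont, alt_G (h.WW_cont _), alt_eq_sum, Finset.mul_sum, ← Finset.sum_add_distrib]
    refine Finset.sum_le_sum fun i hi => ?_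
    have hi := hp.1 (2 * i) (by have := Finset.mem_range.1 hi; omega)
    have : ε / π * (id (p (2 * i + 1)) - id (p (2 * i))) =
      ∫ t in (p (2 * i))..(p (2 * i + 1)), ε / π := by simp; ring
    rw [this, ← intervalIntegral.integral_add
      ((cont_slice (h.WW_cont _) x).intervalIntegrable _ _) (by simp)]
    refine intervalIntegral.integral_mono hi ((cont_slice h.UU_cont x).intervalIntegrable _ _)
      (((cont_slice (h.WW_cont _) x).add continuous_const).intervalIntegrable _ _) fun t => ?_
    have := WW_ge (f := f) (ε / π) x t
    linarith
  have h3 : ε / π * alt id n p ≤ ε := by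
    have := mul_le_mul_of_nonneg_left hp.len_le hτ.le
    rwa [div_mul_cancel₀ _ pi_pos.ne'] at this
  linarith

theorem Sch.slice_le (h : Sch f) {τ : ℝ} (hτ : 0 < τ) (x : ℝ) :
    ∫ t in (0:ℝ)..π, WW f τ x t ≤ ∫ t in (0:ℝ)..π, WW kk τ x t := by
  refine le_of_forall_pos_le_add fun ε' hε' => ?_
  obtain ⟨ε, hε, rfl⟩ : ∃ ε > 0, ε' = π * ε := ⟨ε' / π, by positivity, by field_simp⟩
  have hU := cont_slice h.UU_cont x
  have hWc := cont_slice (h.WW_cont τ) x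
  have huc := (isCompact_Icc (a := (0:ℝ)) (b := π)).uniformContinuousOn_of_continuous hU.continuousOn
  obtain ⟨δ, hδ, hd⟩ := Metric.uniformContinuousOn_iff_le.1 huc ε hε
  obtain ⟨m, hm⟩ := exists_nat_gt (π / δ)
  have hm0 : (0:ℝ) < m := lt_trans (by positivity) hm
  set c := π / m with hc
  have hc0 : 0 < c := by positivity
  have hcδ : c ≤ δ := by
    rw [div_lt_iff₀ hδ] at hm
    rw [hc, div_le_iff₀ hm0]; linarith
  set Y : ℕ → ℝ := fun i => i * c with hY
  have Y0 : Y 0 = 0 := by simp [hY]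
  have Ym : Y m = π := by simp only [hY, hc]; field_simp
  have Ys : ∀ i, Y (i + 1) = Y i + c := fun i => by simp only [hY]; push_cast; ring
  have Ymono : ∀ i j, i ≤ j → Y i ≤ Y j := fun i j hij => by
    simp only [hY]; gcongr
  set p : ℕ → ℝ := fun j => if j % 2 = 0 then Y (j / 2) else
    if τ < UU f x (Y (j / 2)) then Y (j / 2 + 1) else Y (j / 2) with hp
  have pe : ∀ i, p (2 * i) = Y i := fun i => by simp [hp]
  have po : ∀ i, p (2 * i + 1) = if τ < UU f x (Y i) then Y (i + 1) else Y i := fun i => by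
    have h1 : (2 * i + 1) % 2 = 1 := by omega
    have h2 : (2 * i + 1) / 2 = i := by omega
    simp only [hp, h1, h2]; simp
  have po1 : ∀ i, Y i ≤ p (2 * i + 1) := fun i => by
    rw [po]; split_ifs
    · exact Ymono _ _ (by omega)
    · exact le_rfl
  have po2 : ∀ i, p (2 * i + 1) ≤ Y (i + 1) := fun i => by
    rw [po]; split_ifs
    · exact le_rfl
    · exact Ymono _ _ (by omega)
  have hcfg : Cfg m p := by
    refine ⟨fun i _ => ?_, fun i hi => ?_⟩
    · rcases Nat.even_or_odd' i with ⟨k, rfl | rfl⟩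
      · rw [pe]; exact po1 k
      · rw [show 2 * k + 1 + 1 = 2 * (k + 1) by ring, pe]; exact po2 k
    · have : p 0 = 0 := by have := pe 0; rw [mul_zero] at this; rw [this, Y0]
      rw [this, zero_add, ← Ym]
      rcases Nat.even_or_odd' i with ⟨k, rfl | rfl⟩
      · rw [pe]; exact Ymono _ _ (by omega)
      · exact (po2 k).trans (Ymono _ _ (by omega))
  have main := h.compare0 m p hcfg x
  set L := alt id m p with hL
  have hL0 := hcfg.len_nonneg
  have hLp := hcfg.len_le
  -- lower estimate
  have low : (∫ t in (0:ℝ)..π, WW f τ x t) - π * ε ≤ alt (G (UU f) x) m p - τ * L := by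
    have e1 : ∫ t in (0:ℝ)..π, WW f τ x t = ∑ i ∈ Finset.range m, ∫ t in (Y i)..(Y (i + 1)), WW f τ x t := by
      rw [intervalIntegral.sum_integral_adjacent_intervals fun k _ => hWc.intervalIntegrable _ _, Y0, Ym]
    have e2 : π * ε = ∑ i ∈ Finset.range m, c * ε := by
      rw [Finset.sum_const, Finset.card_range, nsmul_eq_mul, hc]; field_simp
    rw [e1, e2, ← Finset.sum_sub_distrib, alt_G h.UU_cont, hL, alt_eq_sum, Finset.mul_sum,
      ← Finset.sum_sub_distrib]
    refine Finset.sum_le_sum fun i hi => ?_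
    have hi := Finset.mem_range.1 hi
    have hYi : 0 ≤ Y i := by rw [← Y0]; exact Ymono _ _ (by omega)
    have hYi1 : Y (i + 1) ≤ π := by rw [← Ym]; exact Ymono _ _ (by omega)
    have hYY := Ys i
    have cell : ∀ t ∈ Icc (Y i) (Y (i + 1)), |UU f x t - UU f x (Y i)| ≤ ε := by
      intro t ht
      have := hd t ⟨by linarith [ht.1], by linarith [ht.2]⟩ (Y i) ⟨hYi, by linarith⟩ (by
        rw [Real.dist_eq, abs_of_nonneg (by linarith [ht.1])]; linarith [ht.2])
      rwa [Real.dist_eq] at this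
    have ec : c * ε = ∫ t in (Y i)..(Y (i + 1)), ε := by rw [hYY]; simp
    rw [ec, ← intervalIntegral.integral_sub (hWc.intervalIntegrable _ _) (by simp), pe, po]
    by_cases hτi : τ < UU f x (Y i)
    · rw [if_pos hτi]
      have : τ * (id (Y (i + 1)) - id (Y i)) = ∫ t in (Y i)..(Y (i + 1)), τ := by simp; ring
      rw [this, ← intervalIntegral.integral_sub (hU.intervalIntegrable _ _) (by simp)]
      refine intervalIntegral.integral_mono_on (by linarith)
        ((hWc.sub continuous_const).intervalIntegrable _ _)
        ((hU.sub continuous_const).intervalIntegrable _ _) fun t ht => ?_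
      have := (abs_le.1 (cell t ht)).1
      have : WW f τ x t ≤ UU f x t - τ + ε := max_le (by linarith) (by linarith)
      linarith
    · rw [if_neg hτi]
      simp only [intervalIntegral.integral_same, sub_self, mul_zero]
      have e0 : (0:ℝ) = ∫ t in (Y i)..(Y (i + 1)), (0:ℝ) := by simp
      rw [e0]
      refine intervalIntegral.integral_mono_on (by linarith)
        ((hWc.sub continuous_const).intervalIntegrable _ _) (by simp) fun t ht => ?_
      have := (abs_le.1 (cell t ht)).2
      have : WW f τ x t ≤ ε := max_le (by linarith) (by linarith)
      linarith
  have up : Vs (UU kk) x (L / 2) - τ * L ≤ ∫ t in (0:ℝ)..π, WW kk τ x t := by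
    have hV := cont_slice sch_kk.UU_cont x
    have hWV := cont_slice (sch_kk.WW_cont τ) x
    have e : τ * L = ∫ t in (-(L / 2))..(L / 2), τ := by simp; ring
    have hper : Function.Periodic (WW kk τ x) π := sch_kk.WW_per τ x
    have e2 := hper.intervalIntegral_add_eq (-(π / 2)) 0
    rw [show -(π / 2) + π = π / 2 by ring, zero_add] at e2
    rw [← e2, e, Vs, ← intervalIntegral.integral_sub (hV.intervalIntegrable _ _) (by simp)]
    calc _ ≤ ∫ t in (-(L / 2))..(L / 2), WW kk τ x t :=
          intervalIntegral.integral_mono (by linarith)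
            ((hV.sub continuous_const).intervalIntegrable _ _)
            (hWV.intervalIntegrable _ _) fun t => WW_ge _ _ _
      _ ≤ _ := intervalIntegral.integral_mono_interval (by linarith) (by linarith) (by linarith)
          (Eventually.of_forall fun t => WW_nonneg _ _ _) (hWV.intervalIntegrable _ _)
  linarith

end BStar


namespace BStar

def Ser (c : ℕ → ℂ) (F : ℂ → ℂ) : Prop :=
  ∀ z ∈ Metric.ball (0:ℂ) 1, HasSum (fun n => c n * z ^ n) (F z)

variable {c : ℕ → ℂ} {F : ℂ → ℂ} {ρ : ℝ}

theorem Ser.summable (h : Ser c F) (h0 : 0 ≤ ρ) (h1 : ρ < 1) : Summable fun n => ‖c n‖ * ρ ^ n := by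
  have := (h ρ (by simpa [abs_of_nonneg h0] using h1)).summable.norm
  simpa [abs_of_nonneg h0] using this

theorem Ser.diff (h : Ser c F) : DifferentiableOn ℂ F (Metric.ball 0 1) := by
  intro z hz
  obtain ⟨ρ, hzρ, hρ⟩ := exists_between (mem_ball_zero_iff.1 hz)
  have h0 : 0 ≤ ρ := (norm_nonneg z).trans hzρ.le
  have hd : DifferentiableOn ℂ (fun z => ∑' n, c n * z ^ n) (Metric.ball 0 ρ) := by
    refine Complex.differentiableOn_tsum_of_summable_norm (h.summable h0 hρ)
      (fun i => by fun_prop) Metric.isOpen_ball fun i w hw => ?_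
    rw [norm_mul, norm_pow]
    have := (mem_ball_zero_iff.1 hw).le
    gcongr
  have he : ∀ w ∈ Metric.ball (0:ℂ) ρ, F w = ∑' n, c n * w ^ n := fun w hw =>
    (h w (Metric.ball_subset_ball hρ.le hw)).tsum_eq.symm
  have := (hd.congr he).differentiableAt (Metric.isOpen_ball.mem_nhds (mem_ball_zero_iff.2 hzρ))
  exact this.differentiableWithinAt

theorem Ser.zero (h : Ser c F) : F 0 = c 0 := by
  have h1 := h 0 (by simp)
  have h2 : HasSum (fun n => c n * (0:ℂ) ^ n) (c 0) := by
    convert hasSum_single (f := fun n => c n * (0:ℂ) ^ n) 0 ?_ using 1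
    · simp
    · intro n hn; simp [hn]
  exact h1.unique h2

theorem Ser.shift (h : Ser c F) : ∃ H, Ser (fun n => c (n + 1)) H ∧
    ∀ z ∈ Metric.ball (0:ℂ) 1, F z = c 0 + z * H z := by
  have key : ∀ z ∈ Metric.ball (0:ℂ) 1, Summable fun n => c (n + 1) * z ^ n := by
    intro z hz
    obtain ⟨ρ, hzρ, hρ⟩ := exists_between (mem_ball_zero_iff.1 hz)
    have h0 : 0 < ρ := (norm_nonneg z).trans_lt hzρ
    have hs := ((summable_nat_add_iff 1).2 (h.summable h0.le hρ)).mul_left ρ⁻¹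
    refine Summable.of_norm_bounded hs fun n => ?_
    rw [norm_mul, norm_pow, pow_succ]
    have : ρ⁻¹ * (‖c (n + 1)‖ * (ρ ^ n * ρ)) = ‖c (n + 1)‖ * ρ ^ n := by field_simp
    rw [this]; gcongr
  refine ⟨fun z => ∑' n, c (n + 1) * z ^ n, fun z hz => (key z hz).hasSum, fun z hz => ?_⟩
  have h1 := (hasSum_nat_add_iff' 1).2 (h z hz)
  simp only [Finset.range_one, Finset.sum_singleton, pow_zero, mul_one] at h1
  have h2 := (key z hz).hasSum.mul_left z
  have h3 : (fun n => z * (c (n + 1) * z ^ n)) = fun n => c (n + 1) * z ^ (n + 1) := by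
    funext n; ring
  rw [h3] at h2
  have := h1.unique h2
  linear_combination this

/-- square mean over a circle -/
noncomputable def AA (ρ : ℝ) (φ : ℂ → ℂ) : ℝ := ∫ θ in (0:ℝ)..(2 * π), ‖φ (circleMap 0 ρ θ)‖ ^ 2

theorem circ_mem (h0 : 0 ≤ ρ) (h1 : ρ < 1) (θ : ℝ) : circleMap 0 ρ θ ∈ Metric.ball (0:ℂ) 1 := by
  simpa [abs_of_nonneg h0] using h1

theorem circ_cont (h0 : 0 ≤ ρ) (h1 : ρ < 1) {φ : ℂ → ℂ} (hφ : DifferentiableOn ℂ φ (Metric.ball 0 1)) :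
    Continuous fun θ => φ (circleMap 0 ρ θ) :=
  hφ.continuousOn.comp_continuous (continuous_circleMap 0 ρ) (circ_mem h0 h1)

theorem AA_step (h0 : 0 ≤ ρ) (h1 : ρ < 1) {φ : ℂ → ℂ} (hφ : DifferentiableOn ℂ φ (Metric.ball 0 1))
    (hz : φ 0 = 0) (a : ℂ) : AA ρ (fun z => a + φ z) = 2 * π * ‖a‖ ^ 2 + AA ρ φ := by
  have hc := circ_cont h0 h1 hφ
  have hd : DiffContOnCl ℂ φ (Metric.ball 0 |ρ|) := by
    rw [abs_of_nonneg h0]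
    refine (hφ.mono ?_).diffContOnCl
    exact Metric.closure_ball_subset_closedBall.trans (Metric.closedBall_subset_ball h1)
  have hm := hd.circleAverage
  rw [hz, Real.circleAverage_def] at hm
  have hi : ∫ θ in (0:ℝ)..(2 * π), φ (circleMap 0 ρ θ) = 0 := by
    rcases smul_eq_zero.1 hm with h | h
    · exact absurd h (inv_ne_zero (by positivity))
    · exact h
  have hi2 : ∫ θ in (0:ℝ)..(2 * π), (2 * ((starRingEnd ℂ a) * φ (circleMap 0 ρ θ)).re) = 0 := by
    rw [intervalIntegral.integral_const_mul]
    have : ∫ θ in (0:ℝ)..(2 * π), ((starRingEnd ℂ a) * φ (circleMap 0 ρ θ)).re =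
        (∫ θ in (0:ℝ)..(2 * π), (starRingEnd ℂ a) * φ (circleMap 0 ρ θ)).re := by
      have := Complex.reCLM.intervalIntegral_comp_comm (μ := volume) (a := 0) (b := 2 * π)
        (f := fun θ => (starRingEnd ℂ a) * φ (circleMap 0 ρ θ))
        (Continuous.intervalIntegrable (continuous_const.mul hc) _ _)
      simpa using this
    rw [this, intervalIntegral.integral_const_mul, hi]; simp
  unfold AA
  have e : ∀ θ, ‖a + φ (circleMap 0 ρ θ)‖ ^ 2 = ‖a‖ ^ 2 +
      (2 * ((starRingEnd ℂ a) * φ (circleMap 0 ρ θ)).re + ‖φ (circleMap 0 ρ θ)‖ ^ 2) := by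
    intro θ
    generalize φ (circleMap 0 ρ θ) = b
    simp only [← Complex.normSq_eq_norm_sq, Complex.normSq_apply, Complex.add_re, Complex.add_im,
      Complex.mul_re, Complex.conj_re, Complex.conj_im]
    ring
  simp_rw [e]
  have c1 : Continuous fun θ => 2 * ((starRingEnd ℂ a) * φ (circleMap 0 ρ θ)).re :=
    continuous_const.mul (Complex.continuous_re.comp (continuous_const.mul hc))
  have c2 : Continuous fun θ => ‖φ (circleMap 0 ρ θ)‖ ^ 2 := hc.norm.pow 2
  have c3 : Continuous fun θ => 2 * ((starRingEnd ℂ a) * φ (circleMap 0 ρ θ)).re +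
      ‖φ (circleMap 0 ρ θ)‖ ^ 2 := c1.add c2
  rw [intervalIntegral.integral_add (by simp) (c3.intervalIntegrable _ _),
    intervalIntegral.integral_add (c1.intervalIntegrable _ _) (c2.intervalIntegrable _ _), hi2]
  simp

theorem AA_iter (h0 : 0 ≤ ρ) (h1 : ρ < 1) {w : ℂ → ℂ} (hw : DifferentiableOn ℂ w (Metric.ball 0 1))
    (hmap : MapsTo w (Metric.ball 0 1) (Metric.ball 0 1)) (hw0 : w 0 = 0)
    (hwρ : ∀ θ, ‖w (circleMap 0 ρ θ)‖ ≤ ρ) (n : ℕ) : ∀ {c : ℕ → ℂ} {F : ℂ → ℂ}, Ser c F →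
    ∃ H, Ser (fun j => c (j + n)) H ∧
      (AA ρ (fun z => F (w z)) ≤ 2 * π * ∑ j ∈ Finset.range n, ‖c j‖ ^ 2 * ρ ^ (2 * j) +
        ρ ^ (2 * n) * AA ρ (fun z => H (w z))) ∧
      (w = id → AA ρ (fun z => F (w z)) = 2 * π * ∑ j ∈ Finset.range n, ‖c j‖ ^ 2 * ρ ^ (2 * j) +
        ρ ^ (2 * n) * AA ρ (fun z => H (w z))) := by
  induction n with
  | zero => intro c F h; exact ⟨F, h, by simp, by simp⟩
  | succ n ih =>
    intro c F h
    obtain ⟨H, hH, e⟩ := h.shift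
    obtain ⟨K, hK, l1, l2⟩ := ih hH
    have hdH : DifferentiableOn ℂ (fun z => H (w z)) (Metric.ball 0 1) := hH.diff.comp hw hmap
    have hstep := AA_step h0 h1 (φ := fun z => w z * H (w z)) (hw.mul hdH) (by simp [hw0]) (c 0)
    have e1 : AA ρ (fun z => F (w z)) = AA ρ (fun z => c 0 + w z * H (w z)) := by
      unfold AA
      refine intervalIntegral.integral_congr fun θ _ => ?_
      simp only
      rw [e _ (hmap (circ_mem h0 h1 θ))]
    have e2 : ∀ θ, ‖w (circleMap 0 ρ θ) * H (w (circleMap 0 ρ θ))‖ ^ 2 =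
      ‖w (circleMap 0 ρ θ)‖ ^ 2 * ‖H (w (circleMap 0 ρ θ))‖ ^ 2 := fun θ => by
        rw [norm_mul, mul_pow]
    have e3 : AA ρ (fun z => w z * H (w z)) ≤ ρ ^ 2 * AA ρ (fun z => H (w z)) := by
      unfold AA
      rw [← intervalIntegral.integral_const_mul]
      refine intervalIntegral.integral_mono (by positivity)
        (((circ_cont h0 h1 (hw.mul hdH)).norm.pow 2).intervalIntegrable _ _)
        ((continuous_const.mul ((circ_cont h0 h1 hdH).norm.pow 2)).intervalIntegrable _ _) fun θ => ?_
      simp only [e2]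
      have := hwρ θ
      gcongr
    have e4 : w = id → AA ρ (fun z => w z * H (w z)) = ρ ^ 2 * AA ρ (fun z => H (w z)) := by
      rintro rfl
      unfold AA
      rw [← intervalIntegral.integral_const_mul]
      refine intervalIntegral.integral_congr fun θ _ => ?_
      simp only [e2]
      simp
    have e5 : 2 * π * ‖c 0‖ ^ 2 + ρ ^ 2 * (2 * π * ∑ j ∈ Finset.range n, ‖c (j + 1)‖ ^ 2 * ρ ^ (2 * j) +
        ρ ^ (2 * n) * AA ρ (fun z => K (w z))) =
        2 * π * ∑ j ∈ Finset.range (n + 1), ‖c j‖ ^ 2 * ρ ^ (2 * j) +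
        ρ ^ (2 * (n + 1)) * AA ρ (fun z => K (w z)) := by
      rw [Finset.sum_range_succ']
      have : ∑ k ∈ Finset.range n, ‖c (k + 1)‖ ^ 2 * ρ ^ (2 * (k + 1)) =
          ρ ^ 2 * ∑ j ∈ Finset.range n, ‖c (j + 1)‖ ^ 2 * ρ ^ (2 * j) := by
        rw [Finset.mul_sum]
        exact Finset.sum_congr rfl fun i _ => by ring
      rw [this]; ring
    refine ⟨K, ?_, ?_, ?_⟩
    · simpa [add_assoc, add_comm 1 n] using hK
    · rw [e1, hstep, ← e5]
      have : ρ ^ 2 * AA ρ (fun z => H (w z)) ≤ _ := mul_le_mul_of_nonneg_left l1 (sq_nonneg ρ)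
      linarith
    · intro hid
      rw [e1, hstep, ← e5, e4 hid, l2 hid]

theorem Ser.sq_summable (h : Ser c F) (h0 : 0 ≤ ρ) (h1 : ρ < 1) :
    Summable fun n => ‖c n‖ ^ 2 * ρ ^ (2 * n) := by
  have hs := h.summable h0 h1
  have h2 : ∀ n, ‖c n‖ ^ 2 * ρ ^ (2 * n) = (‖c n‖ * ρ ^ n) ^ 2 := fun n => by
    rw [mul_pow, ← pow_mul, mul_comm n 2]
  simp_rw [h2]
  have hb : ∀ᶠ n in atTop, ‖c n‖ * ρ ^ n < 1 :=
    hs.tendsto_atTop_zero.eventually_lt_const one_pos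
  refine Summable.of_norm_bounded_eventually_nat hs (hb.mono fun n hn => ?_)
  have : 0 ≤ ‖c n‖ * ρ ^ n := by positivity
  rw [Real.norm_of_nonneg (by positivity)]
  nlinarith

theorem AA_nonneg (φ : ℂ → ℂ) : 0 ≤ AA ρ φ :=
  intervalIntegral.integral_nonneg (by positivity) fun _ _ => by positivity

theorem littlewood (h : Ser c F) (h0 : 0 ≤ ρ) (h1 : ρ < 1) {w : ℂ → ℂ}
    (hw : DifferentiableOn ℂ w (Metric.ball 0 1))
    (hmap : MapsTo w (Metric.ball 0 1) (Metric.ball 0 1)) (hw0 : w 0 = 0)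
    (hwρ : ∀ θ, ‖w (circleMap 0 ρ θ)‖ ≤ ρ) :
    (AA ρ (fun z => F (w z)) ≤ 2 * π * ∑' n, ‖c n‖ ^ 2 * ρ ^ (2 * n)) ∧
    (w = id → AA ρ (fun z => F (w z)) = 2 * π * ∑' n, ‖c n‖ ^ 2 * ρ ^ (2 * n)) := by
  have hs := h.sq_summable h0 h1
  choose H hH l1 l2 using fun n => AA_iter h0 h1 hw hmap hw0 hwρ n h
  set T : ℕ → ℝ := fun n => ∑' j, ‖c (j + n)‖ * ρ ^ (j + n) with hT
  have hT0 : Tendsto T atTop (𝓝 0) := tendsto_sum_nat_add fun n => ‖c n‖ * ρ ^ n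
  have hrem : ∀ n, ρ ^ (2 * n) * AA ρ (fun z => H n (w z)) ≤ 2 * π * T n ^ 2 := by
    intro n
    unfold AA
    rw [← intervalIntegral.integral_const_mul]
    calc _ ≤ ∫ θ in (0:ℝ)..(2 * π), T n ^ 2 := by
          refine intervalIntegral.integral_mono (by positivity)
            ((continuous_const.mul ((circ_cont h0 h1 ((hH n).diff.comp hw hmap)).norm.pow
              2)).intervalIntegrable _ _) (by simp) fun θ => ?_
          simp only
          have e : ρ ^ (2 * n) * ‖H n (w (circleMap 0 ρ θ))‖ ^ 2 =
            (ρ ^ n * ‖H n (w (circleMap 0 ρ θ))‖) ^ 2 := by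
              rw [mul_pow, ← pow_mul, mul_comm n 2]
          rw [e]
          have hle : ρ ^ n * ‖H n (w (circleMap 0 ρ θ))‖ ≤ T n := by
            have hsum := hH n (w (circleMap 0 ρ θ)) (hmap (circ_mem h0 h1 θ))
            have hn := hsum.summable.norm
            have hsn := (summable_nat_add_iff n).2 (h.summable h0 h1)
            have hb : ‖H n (w (circleMap 0 ρ θ))‖ ≤ ∑' j, ‖c (j + n) * w (circleMap 0 ρ θ) ^ j‖ := by
              rw [← hsum.tsum_eq]; exact norm_tsum_le_tsum_norm hn
            calc _ ≤ ρ ^ n * ∑' j, ‖c (j + n) * w (circleMap 0 ρ θ) ^ j‖ := by gcongr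
              _ = ∑' j, ρ ^ n * ‖c (j + n) * w (circleMap 0 ρ θ) ^ j‖ := tsum_mul_left.symm
              _ ≤ T n := by
                refine (hn.mul_left _).tsum_le_tsum (fun j => ?_) hsn
                rw [norm_mul, norm_pow, pow_add]
                have := pow_le_pow_left₀ (norm_nonneg _) (hwρ θ) j
                calc _ ≤ ρ ^ n * (‖c (j + n)‖ * ρ ^ j) := by gcongr
                  _ = _ := by ring
          gcongr
      _ = _ := by simp
  have hlim : Tendsto (fun n => 2 * π * ∑ j ∈ Finset.range n, ‖c j‖ ^ 2 * ρ ^ (2 * j) +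
      ρ ^ (2 * n) * AA ρ (fun z => H n (w z))) atTop
      (𝓝 (2 * π * ∑' n, ‖c n‖ ^ 2 * ρ ^ (2 * n) + 0)) := by
    refine (hs.hasSum.tendsto_sum_nat.const_mul _).add ?_
    refine squeeze_zero (fun n => mul_nonneg (by positivity) (AA_nonneg _)) hrem ?_
    simpa using (hT0.pow 2).const_mul (2 * π)
  rw [add_zero] at hlim
  refine ⟨ge_of_tendsto' hlim l1, fun hid => ?_⟩
  refine tendsto_nhds_unique ?_ hlim
  exact tendsto_const_nhds.congr fun n => l2 n hid

theorem parseval (h : Ser c F) (h0 : 0 ≤ ρ) (h1 : ρ < 1) :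
    AA ρ F = 2 * π * ∑' n, ‖c n‖ ^ 2 * ρ ^ (2 * n) :=
  (littlewood h h0 h1 (w := id) differentiableOn_id (mapsTo_id _) rfl
    (fun θ => by simp [abs_of_nonneg h0])).2 rfl

end BStar


namespace BStar
variable {f : ℂ → ℂ}

theorem polar {G : ℂ → ENNReal} (hG : Measurable G) :
    ∫⁻ w, G w = ∫⁻ R in Ioi (0:ℝ), ENNReal.ofReal R *
      ∫⁻ y in Ioo (-π) π, G (circleMap 0 R y) := by
  have hc : Measurable fun p : ℝ × ℝ => circleMap 0 p.1 p.2 := by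
    unfold circleMap
    fun_prop
  have e : ∀ p : ℝ × ℝ, Complex.polarCoord.symm p = circleMap 0 p.1 p.2 := by
    intro p
    rw [Complex.polarCoord_symm_apply, circleMap, Complex.exp_mul_I]; push_cast; ring
  rw [← Complex.lintegral_comp_polarCoord_symm, polarCoord_target]
  simp_rw [e, smul_eq_mul]
  rw [Measure.volume_eq_prod, setLIntegral_prod]
  · refine setLIntegral_congr_fun measurableSet_Ioi fun R _ => ?_
    simp only
    rw [lintegral_const_mul]
    exact hG.comp (hc.comp measurable_prodMk_left)
  · exact ((ENNReal.measurable_ofReal.comp measurable_fst).mul (hG.comp hc)).aemeasurable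

theorem Sch.uu_meas (h : Sch f) : Measurable (uu f) := by
  refine measurable_of_continuousOn_compl_singleton 0 fun w hw => ?_
  exact (h.uu_cont hw).continuousWithinAt

noncomputable def JJ (f : ℂ → ℂ) (τ : ℝ) : ENNReal := ∫⁻ w, ENNReal.ofReal (max (uu f w - τ) 0)

theorem per_int {φ : ℝ → ℝ} (hc : Continuous φ) (h0 : ∀ y, 0 ≤ φ y)
    (hp : Function.Periodic φ (2 * π)) :
    ∫⁻ y in Ioo (-π) π, ENNReal.ofReal (φ y) = ENNReal.ofReal (∫ y in (0:ℝ)..(2 * π), φ y) := by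
  have e := hp.intervalIntegral_add_eq (-π) 0
  rw [zero_add, show -π + 2 * π = π by ring] at e
  rw [← e, intervalIntegral.integral_of_le (by linarith [pi_pos]),
    integral_Ioc_eq_integral_Ioo,
    ofReal_integral_eq_lintegral_ofReal]
  · exact (hc.integrableOn_Icc (a := -π) (b := π)).mono_set Ioo_subset_Icc_self
  · exact Eventually.of_forall h0

theorem Sch.JJ_eq (h : Sch f) (τ : ℝ) : JJ f τ = ∫⁻ R in Ioi (0:ℝ), ENNReal.ofReal R *
    ENNReal.ofReal (2 * ∫ t in (0:ℝ)..π, WW f τ (Real.log R) t) := by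
  unfold JJ
  have hm : Measurable fun w => ENNReal.ofReal (max (uu f w - τ) 0) :=
    ENNReal.measurable_ofReal.comp ((h.uu_meas.sub_const τ).max measurable_const)
  rw [polar hm]
  refine setLIntegral_congr_fun measurableSet_Ioi fun R hR => ?_
  have hR : 0 < R := hR
  congr 1
  have e : ∀ y, max (uu f (circleMap 0 R y) - τ) 0 = WW f τ (Real.log R) y := by
    intro y
    have : Complex.exp ((Real.log R : ℝ) + y * Complex.I) = circleMap 0 R y := by
      rw [Complex.exp_add, ← Complex.ofReal_exp, Real.exp_log hR, circleMap, zero_add]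
    rw [WW, UU, this]
  simp_rw [e]
  have hc : Continuous fun y => WW f τ (Real.log R) y :=
    (h.WW_cont τ).comp (Continuous.prodMk_right (Real.log R))
  have hp : Function.Periodic (fun y => WW f τ (Real.log R) y) π := fun y => h.WW_per τ _ y
  have hp2 : Function.Periodic (fun y => WW f τ (Real.log R) y) (2 * π) := by
    simpa using hp.nat_mul 2
  rw [per_int hc (fun y => WW_nonneg τ _ y) hp2]
  congr 1
  rw [← intervalIntegral.integral_add_adjacent_intervals (b := π) (hc.intervalIntegrable _ _)
    (hc.intervalIntegrable _ _)]
  have e2 := hp.intervalIntegral_add_eq 0 π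
  rw [zero_add, ← two_mul] at e2
  rw [← e2]; ring

theorem Sch.JJ_le (h : Sch f) {τ : ℝ} (hτ : 0 < τ) : JJ f τ ≤ JJ kk τ := by
  rw [h.JJ_eq, sch_kk.JJ_eq]
  refine lintegral_mono fun R => ?_
  have := h.slice_le hτ (Real.log R)
  simp only
  gcongr

theorem lint (n : ℕ) {τ : ℝ} (hτ : 0 < τ) :
    ∫⁻ R in Ioi (0:ℝ), ENNReal.ofReal (R ^ (2 * n + 1) * max (- Real.log R - τ) 0) =
      ENNReal.ofReal (Real.exp (-τ) ^ (2 * (n + 1)) / (4 * (n + 1) ^ 2)) := by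
  set s := Real.exp (-τ) with hs
  have s0 : 0 < s := Real.exp_pos _
  have hls : Real.log s = -τ := Real.log_exp _
  have c0 : Continuous fun R : ℝ => R ^ (2 * n) * (- (R * Real.log R) - R * τ) := by
    have := Real.continuous_mul_log
    fun_prop
  have hF : ∫ R in (0:ℝ)..s, R ^ (2 * n) * (- (R * Real.log R) - R * τ) =
      s ^ (2 * (n + 1)) / (4 * (n + 1) ^ 2) := by
    have := intervalIntegral.integral_eq_sub_of_hasDerivAt_of_le (a := 0) (b := s)
      (f := fun R : ℝ => R ^ (2 * n + 1) * (- (R * Real.log R) - R * τ) / (2 * (n + 1)) +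
        R ^ (2 * (n + 1)) / (4 * (n + 1) ^ 2))
      (f' := fun R : ℝ => R ^ (2 * n) * (- (R * Real.log R) - R * τ)) s0.le ?_ ?_
      (c0.intervalIntegrable _ _)
    · rw [this, hls]; simp
    · have := Real.continuous_mul_log
      apply Continuous.continuousOn
      fun_prop
    · intro R hR
      have hR0 : R ≠ 0 := hR.1.ne'
      have h1 := (((hasDerivAt_pow (2 * n + 1) R).mul
        (((Real.hasDerivAt_mul_log hR0).neg).sub ((hasDerivAt_id R).mul_const τ))).div_const
        (2 * ((n:ℝ) + 1))).add ((hasDerivAt_pow (2 * (n + 1)) R).div_const (4 * ((n:ℝ) + 1) ^ 2))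
      refine h1.congr_deriv ?_
      have e1 : 2 * (n + 1) - 1 = 2 * n + 1 := by omega
      have : (n:ℝ) + 1 ≠ 0 := by positivity
      simp only [e1, Nat.add_sub_cancel, id]
      push_cast
      field_simp
      simp
      ring
  rw [← hF, intervalIntegral.integral_of_le s0.le, ofReal_integral_eq_lintegral_ofReal]
  · have hI : Ioi (0:ℝ) = Ioc 0 s ∪ Ioi s := (Ioc_union_Ioi_eq_Ioi s0.le).symm
    rw [hI, lintegral_union measurableSet_Ioi (Set.Ioc_disjoint_Ioi le_rfl)]
    have z : ∫⁻ R in Ioi s, ENNReal.ofReal (R ^ (2 * n + 1) * max (- Real.log R - τ) 0) = 0 := by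
      rw [setLIntegral_congr_fun (g := fun _ => 0) measurableSet_Ioi]
      · simp
      · intro R hR
        have : Real.log s ≤ Real.log R := Real.log_le_log s0 (le_of_lt hR)
        simp only
        rw [max_eq_right (by linarith)]; simp
    rw [z, add_zero]
    refine setLIntegral_congr_fun measurableSet_Ioc fun R hR => ?_
    have : Real.log R ≤ Real.log s := Real.log_le_log hR.1 hR.2
    rw [max_eq_left (by linarith)]
    congr 1; ring
  · exact (c0.integrableOn_Icc (a := 0) (b := s)).mono_set Ioc_subset_Icc_self
  · rw [EventuallyLE, ae_restrict_iff' measurableSet_Ioc]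
    refine Eventually.of_forall fun R hR => ?_
    have h1 : Real.log R ≤ Real.log s := Real.log_le_log hR.1 hR.2
    have h2 : 0 ≤ R := hR.1.le
    have : R ^ (2 * n) * (- (R * Real.log R) - R * τ) = R ^ (2 * n) * (R * (- Real.log R - τ)) := by
      ring
    simp only [Pi.zero_apply]
    rw [this]
    have : 0 ≤ - Real.log R - τ := by linarith
    positivity

theorem Sch.JJ_area (h : Sch f) {τ : ℝ} (hτ : 0 < τ) : JJ f τ =
    ∫⁻ z, ENNReal.ofReal (‖deriv f z‖ ^ 2 * max (- Real.log ‖z‖ - τ) 0) := by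
  unfold JJ
  have hm : MeasurableSet (Metric.ball (0:ℂ) 1) := Metric.isOpen_ball.measurableSet
  have e1 : ∫⁻ w, ENNReal.ofReal (max (uu f w - τ) 0) =
      ∫⁻ w in f '' Metric.ball 0 1, ENNReal.ofReal (max (uu f w - τ) 0) := by
    refine (setLIntegral_eq_of_support_subset ?_).symm
    intro w hw
    by_contra hc
    apply hw
    beta_reduce
    rw [uu_of_not hc, max_eq_right (by linarith)]; simp
  have e2 : ∫⁻ z, ENNReal.ofReal (‖deriv f z‖ ^ 2 * max (- Real.log ‖z‖ - τ) 0) =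
      ∫⁻ z in Metric.ball 0 1, ENNReal.ofReal (‖deriv f z‖ ^ 2 * max (- Real.log ‖z‖ - τ) 0) := by
    refine (setLIntegral_eq_of_support_subset ?_).symm
    intro w hw
    by_contra hc
    apply hw
    beta_reduce
    have : 0 ≤ Real.log ‖w‖ := Real.log_nonneg (by simpa using hc)
    rw [max_eq_right (by linarith)]; simp
  rw [e1, e2, lintegral_image_eq_lintegral_abs_det_fderiv_mul volume hm
    (f' := fun z => (fderiv ℂ f z).restrictScalars ℝ) ?_ h.inj]
  · refine setLIntegral_congr_fun hm fun z hz => ?_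
    rw [uu_of_mem (mem_image_of_mem f hz), h.q_f hz]
    have : ((fderiv ℂ f z).restrictScalars ℝ).det = ‖deriv f z‖ ^ 2 := by
      have h1 : ((fderiv ℂ f z).restrictScalars ℝ).det =
        LinearMap.det (((fderiv ℂ f z : ℂ →ₗ[ℂ] ℂ)).restrictScalars ℝ) := rfl
      rw [h1, LinearMap.det_restrictScalars, Algebra.norm_complex_apply, Complex.normSq_eq_norm_sq]
      simp
    rw [this, abs_of_nonneg (by positivity), ENNReal.ofReal_mul (by positivity)]
  · intro z hz
    exact ((h.an hz).differentiableAt.hasFDerivAt.restrictScalars ℝ).hasFDerivWithinAt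

theorem taylor {F : ℂ → ℂ} (hd : DifferentiableOn ℂ F (Metric.ball 0 1)) :
    Ser (fun n => iteratedDeriv n F 0 / n.factorial) F := by
  intro z hz
  have := Complex.hasSum_taylorSeries_on_ball hd hz
  have e : (fun n : ℕ => iteratedDeriv n F 0 / (n.factorial : ℂ) * z ^ n) =
      fun n : ℕ => ((n.factorial : ℂ)⁻¹) • (z - 0) ^ n • iteratedDeriv n F 0 := by
    funext n
    simp only [sub_zero, smul_eq_mul]
    ring
  exact e ▸ this

theorem Sch.JJ_AA (h : Sch f) {τ : ℝ} (hτ : 0 < τ) :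
    JJ f τ = ENNReal.ofReal (AA (Real.exp (-τ)) f / 4) := by
  set s := Real.exp (-τ) with hs
  have s0 : 0 < s := Real.exp_pos _
  have s1 : s < 1 := by rw [hs, Real.exp_lt_one_iff]; linarith
  set t : ℕ → ℂ := fun n => iteratedDeriv n f 0 / n.factorial with ht
  have T1 : Ser t f := taylor h.diff
  have hdd : DifferentiableOn ℂ (deriv f) (Metric.ball 0 1) := h.diff.deriv Metric.isOpen_ball
  have T2 : Ser (fun n => (n + 1) * t (n + 1)) (deriv f) := by
    have := taylor hdd
    convert this using 2 with n
    rw [ht]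
    simp only [iteratedDeriv_succ', Nat.factorial_succ]
    have h1 : (n.factorial : ℂ) ≠ 0 := by exact_mod_cast n.factorial_ne_zero
    have h2 : (n:ℂ) + 1 ≠ 0 := by exact_mod_cast n.succ_ne_zero
    push_cast
    field_simp
  have t0 : t 0 = 0 := by rw [← T1.zero, h.zero]
  have hmeas : Measurable fun z => ENNReal.ofReal (‖deriv f z‖ ^ 2 * max (- Real.log ‖z‖ - τ) 0) := by
    have := measurable_deriv f
    fun_prop
  rw [h.JJ_area hτ, polar hmeas]
  have e1 : ∀ R ∈ Ioi (0:ℝ), ENNReal.ofReal R * ∫⁻ y in Ioo (-π) π, ENNReal.ofReal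
      (‖deriv f (circleMap 0 R y)‖ ^ 2 * max (- Real.log ‖circleMap 0 R y‖ - τ) 0) =
      ∑' n : ℕ, ENNReal.ofReal (2 * π * (((n:ℝ) + 1) ^ 2 * ‖t (n + 1)‖ ^ 2)) *
        ENNReal.ofReal (R ^ (2 * n + 1) * max (- Real.log R - τ) 0) := by
    intro R hR
    have hR : 0 < R := hR
    simp only [norm_circleMap_zero, abs_of_pos hR]
    rcases lt_or_ge R 1 with h1 | h1
    · have hc := ((circ_cont hR.le h1 hdd).norm.pow 2).mul
        (continuous_const (y := max (- Real.log R - τ) 0))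
      have := per_int (φ := fun y => ‖deriv f (circleMap 0 R y)‖ ^ 2 * max (- Real.log R - τ) 0)
        hc (fun y => by positivity) (fun y => by simp only [periodic_circleMap 0 R y])
      rw [this, intervalIntegral.integral_mul_const]
      have hp := parseval T2 hR.le h1
      unfold AA at hp
      rw [hp, ← ENNReal.ofReal_mul hR.le, ← tsum_mul_left, ← tsum_mul_right, ← tsum_mul_left,
        ENNReal.ofReal_tsum_of_nonneg]
      · refine tsum_congr fun n => ?_
        rw [← ENNReal.ofReal_mul (by positivity)]
        congr 1
        rw [norm_mul, mul_pow]
        have : ‖(n:ℂ) + 1‖ = n + 1 := by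
          have := Complex.norm_natCast (n + 1)
          push_cast at this; exact this
        rw [this]; ring
      · intro n; positivity
      · exact (((T2.sq_summable hR.le h1).mul_left _).mul_right _).mul_left _
    · have : 0 ≤ Real.log R := Real.log_nonneg h1
      rw [max_eq_right (by linarith)]; simp
  rw [setLIntegral_congr_fun measurableSet_Ioi e1, lintegral_tsum]
  · have e2 : ∀ n : ℕ, ∫⁻ R in Ioi (0:ℝ), ENNReal.ofReal (2 * π * (((n:ℝ) + 1) ^ 2 * ‖t (n + 1)‖ ^ 2)) *
        ENNReal.ofReal (R ^ (2 * n + 1) * max (- Real.log R - τ) 0) =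
        ENNReal.ofReal (2 * π * (‖t (n + 1)‖ ^ 2 * s ^ (2 * (n + 1))) / 4) := by
      intro n
      rw [lintegral_const_mul _ (by fun_prop), lint n hτ, ← ENNReal.ofReal_mul (by positivity)]
      congr 1
      field_simp
      rw [hs]
    simp_rw [e2]
    have S := T1.sq_summable s0.le s1
    have S2 := (summable_nat_add_iff 1).2 S
    rw [← ENNReal.ofReal_tsum_of_nonneg (fun n => by positivity) ((S2.mul_left _).div_const _),
      parseval T1 s0.le s1, S.tsum_eq_zero_add, t0, tsum_div_const, tsum_mul_left]
    simp
  · intro n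
    fun_prop

theorem Sch.AA_le (h : Sch f) {s : ℝ} (h0 : 0 < s) (h1 : s < 1) : AA s f ≤ AA s kk := by
  have hτ : 0 < - Real.log s := by linarith [Real.log_neg h0 h1]
  have := h.JJ_le hτ
  rw [h.JJ_AA hτ, sch_kk.JJ_AA hτ, neg_neg, Real.exp_log h0, ENNReal.ofReal_le_ofReal_iff
    (div_nonneg (AA_nonneg _) (by norm_num))] at this
  linarith

end BStar


namespace BStar

theorem _root_.HasSum.congr_feq {E : Type*} [AddCommMonoid E] [TopologicalSpace E] {u v : ℕ → E} {x : E}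
    (h : HasSum u x) (e : v = u) : HasSum v x := e ▸ h

theorem odd_ser {a : ℕ → ℂ} {f : ℂ → ℂ}
    (hf : ∀ z ∈ Metric.ball (0:ℂ) 1, HasSum (fun k => a k * z ^ (2 * k + 1)) (f z)) :
    Ser (fun m => if m % 2 = 1 then a (m / 2) else 0) f := by
  intro z hz
  have hi : Function.Injective fun k : ℕ => 2 * k + 1 := fun i j h => by simpa using h
  refine (hi.hasSum_iff ?_).1 ?_
  · intro m hm
    have : ¬ m % 2 = 1 := fun h => hm ⟨m / 2, by simp only; omega⟩
    simp [this]
  · convert hf z hz using 2 with k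
    have e1 : (2 * k + 1) % 2 = 1 := by omega
    have e2 : (2 * k + 1) / 2 = k := by omega
    simp only [Function.comp, e1, e2, if_true]

theorem AA_kk {s : ℝ} (h0 : 0 < s) (h1 : s < 1) : AA s kk = 2 * π * (s ^ 2 / (1 - s ^ 4)) := by
  have hk : ∀ z ∈ Metric.ball (0:ℂ) 1, HasSum (fun k : ℕ => (fun _ => (1:ℂ)) k * z ^ (2 * k + 1)) (kk z) := by
    intro z hz
    have hz1 : ‖z ^ 2‖ < 1 := by
      rw [norm_pow]; exact pow_lt_one₀ (norm_nonneg _) (mem_ball_zero_iff.1 hz) two_ne_zero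
    have := (hasSum_geometric_of_norm_lt_one hz1).mul_left z
    have e : (fun k : ℕ => (fun _ => (1:ℂ)) k * z ^ (2 * k + 1)) = fun k => z * (z ^ 2) ^ k := by
      funext k
      simp only [one_mul]
      ring
    rw [e, kk, div_eq_mul_inv]
    exact this
  rw [parseval (odd_ser hk) h0.le h1]
  congr 1
  have hi : Function.Injective fun k : ℕ => 2 * k + 1 := fun i j h => by simpa using h
  refine HasSum.tsum_eq ((hi.hasSum_iff ?_).1 ?_)
  · intro m hm
    have : ¬ m % 2 = 1 := fun h => hm ⟨m / 2, by simp only; omega⟩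
    simp [this]
  · have h4 : s ^ 4 < 1 := pow_lt_one₀ h0.le h1 (by norm_num)
    have := (hasSum_geometric_of_lt_one (by positivity) h4).mul_left (s ^ 2)
    rw [div_eq_mul_inv]
    refine this.congr_feq (funext fun k => ?_)
    have e1 : (2 * k + 1) % 2 = 1 := by omega
    simp only [Function.comp, e1, if_true, norm_one]
    ring

theorem mk_sch {a : ℕ → ℂ} {f : ℂ → ℂ}
    (hf : ∀ z ∈ Metric.ball (0:ℂ) 1, HasSum (fun k => a k * z ^ (2 * k + 1)) (f z))
    (ha : a 0 = 1) (hi : InjOn f (Metric.ball 0 1)) : Sch f := by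
  have hs := odd_ser hf
  refine ⟨hs.diff, hi, fun z hz => ?_, ?_⟩
  · have h1 := hf (-z) (by simpa using hz)
    have h2 := (hf z hz).neg
    refine h1.unique ?_
    refine h2.congr_feq (funext fun k => ?_)
    rw [Odd.neg_pow ⟨k, rfl⟩]; ring
  · obtain ⟨H, hH, e⟩ := hs.shift
    have hb : Metric.ball (0:ℂ) 1 ∈ 𝓝 (0:ℂ) := Metric.isOpen_ball.mem_nhds (by simp)
    have e2 : f =ᶠ[𝓝 0] fun z => z * H z := by
      filter_upwards [hb] with z hz
      rw [e z hz]; simp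
    rw [e2.deriv_eq]
    have hd := (hH.diff.differentiableAt hb).hasDerivAt
    have := ((hasDerivAt_id (0:ℂ)).mul hd).deriv
    have h3 : H 0 = 1 := by rw [hH.zero]; simpa using ha
    simp only [id, one_mul, zero_mul, add_zero, h3] at this
    exact this

theorem main {f g : ℂ → ℂ} {a b : ℕ → ℂ}
    (hf : ∀ z ∈ Metric.ball (0:ℂ) 1, HasSum (fun k => a k * z ^ (2 * k + 1)) (f z))
    (ha : a 0 = 1) (hi : InjOn f (Metric.ball 0 1))
    (hg : ∀ z ∈ Metric.ball (0:ℂ) 1, HasSum (fun n => b n * z ^ (n + 1)) (g z))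
    {w : ℂ → ℂ} (hw : DifferentiableOn ℂ w (Metric.ball 0 1)) (hw0 : w 0 = 0)
    (hmap : MapsTo w (Metric.ball 0 1) (Metric.ball 0 1))
    (he : ∀ z ∈ Metric.ball (0:ℂ) 1, g z = f (w z)) {r : ℝ} (hr0 : 0 ≤ r) (hr1 : r < 1) :
    ∑' n, ‖b n‖ ^ 2 * r ^ (n + 1) ≤ r / (1 - r ^ 2) := by
  rcases hr0.eq_or_lt with rfl | hr
  · simp
  set ρ := Real.sqrt r with hρ
  have p0 : 0 < ρ := Real.sqrt_pos.2 hr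
  have p2 : ρ ^ 2 = r := Real.sq_sqrt hr0
  have p1 : ρ < 1 := by rw [hρ, Real.sqrt_lt' one_pos]; simpa using hr1
  have hS := mk_sch hf ha hi
  have hgS : Ser (fun n => if n = 0 then 0 else b (n - 1)) g := by
    intro z hz
    rw [← hasSum_nat_add_iff' 1]
    simpa using hg z hz
  have hwρ : ∀ θ, ‖w (circleMap 0 ρ θ)‖ ≤ ρ := by
    intro θ
    have hm := circ_mem p0.le p1 θ
    have := Complex.norm_le_norm_of_mapsTo_ball hw (hmap.mono_right Metric.ball_subset_closedBall) hw0 (mem_ball_zero_iff.1 hm)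
    simpa [abs_of_pos p0] using this
  have L := (littlewood (odd_ser hf) p0.le p1 hw hmap hw0 hwρ).1
  rw [← parseval (odd_ser hf) p0.le p1] at L
  have e1 : AA ρ g = AA ρ fun z => f (w z) := by
    unfold AA
    refine intervalIntegral.integral_congr fun θ _ => ?_
    simp only [he _ (circ_mem p0.le p1 θ)]
  have key := (e1.le.trans L).trans ((hS.AA_le p0 p1).trans (AA_kk p0 p1).le)
  rw [parseval hgS p0.le p1] at key
  have key2 := le_of_mul_le_mul_left key (by positivity)
  rw [(hgS.sq_summable p0.le p1).tsum_eq_zero_add] at key2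
  have e3 : ρ ^ 4 = r ^ 2 := by rw [← p2]; ring
  simp only [pow_mul, p2, e3] at key2
  simpa using key2

end BStar


end

/-- If `g(z) = ∑_{n≥1} b_n z^n` is subordinate to an odd univalent function
`f(z) = ∑_{k≥1} a_{2k-1} z^{2k-1}` with `a_1 = 1`, then
`∑_{n≥1} |b_n|² r^n ≤ r/(1-r²)` for all `0 ≤ r < 1`. -/
theorem subordinate_square_sum_bound (f g : ℂ → ℂ) (a b : ℕ → ℂ)
    (hf : ∀ z ∈ Metric.ball (0 : ℂ) 1, HasSum (fun k : ℕ => a k * z ^ (2 * k + 1)) (f z))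
    (ha1 : a 0 = 1)
    (huniv : Set.InjOn f (Metric.ball (0 : ℂ) 1))
    (hg : ∀ z ∈ Metric.ball (0 : ℂ) 1, HasSum (fun n : ℕ => b n * z ^ (n + 1)) (g z))
    (hsub : ∃ w : ℂ → ℂ, AnalyticOn ℂ w (Metric.ball (0 : ℂ) 1) ∧ w 0 = 0 ∧
      (∀ z ∈ Metric.ball (0 : ℂ) 1, w z ∈ Metric.ball (0 : ℂ) 1) ∧
      (∀ z ∈ Metric.ball (0 : ℂ) 1, g z = f (w z))) :
    ∀ r : ℝ, 0 ≤ r → r < 1 →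
      ∑' n : ℕ, ‖b n‖ ^ 2 * r ^ (n + 1) ≤ r / (1 - r ^ 2) := by
  obtain ⟨w, hw, hw0, hmap, he⟩ := hsub
  intro r hr0 hr1
  exact BStar.main hf ha1 huniv hg hw.differentiableOn hw0 hmap he hr0 hr1
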